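/- arXiv:2508.06185 — 2 statements merged into one kernel-verified Lean document; each statement's English description precedes it below -/
import Mathlib

section
/- (Classification Theorem) Let A, B ∈ SL(2,ℝ) and let Ā, B̄ denote their images in PSL(2,ℝ). Then the subgroup of PSL(2,ℝ) generated by Ā and B̄ is discrete and freely generated by Ā and B̄ (i.e., is a free Fuchsian group of rank 2) if and only if either (a) tr([A,B]) ≤ −2, or (b) there exist U, V ∈ SL(2,ℝ) with 2 ≤ tr(U) ≤ tr(V) and tr(U·V) ≤ −2 such that the pair of images (Ū, V̄) in PSL(2,ℝ) is Nielsen equivalent to (Ā, B̄). Moreover, in case (b) one has tr([A,B]) ≥ 18. -/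
abbrev SL2R := Matrix.SpecialLinearGroup (Fin 2) ℝ

noncomputable instance : TopologicalSpace SL2R :=
  inferInstanceAs (TopologicalSpace {A : Matrix (Fin 2) (Fin 2) ℝ // A.det = 1})

/-- `PSL(2,ℝ)`, the quotient of `SL(2,ℝ)` by its center `{I, -I}`,
endowed with the quotient topology. -/
abbrev PSL2R := SL2R ⧸ Subgroup.center SL2R

/-- The canonical projection `SL(2,ℝ) → PSL(2,ℝ)`. -/
def projPSL : SL2R →* PSL2R := QuotientGroup.mk' (Subgroup.center SL2R)

/-- The trace of an element of `SL(2, ℝ)`, viewed as a matrix. -/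
noncomputable def trSL (A : SL2R) : ℝ :=
  Matrix.trace (A : Matrix (Fin 2) (Fin 2) ℝ)

/-- `(a, b)` is a *free Fuchsian pair* if the subgroup of `PSL(2,ℝ)` generated by
`a` and `b` is discrete (as a topological subgroup) and is freely generated by `a`
and `b` as a free group of rank 2, i.e. the homomorphism from the free group on two
generators sending the generators to `a` and `b` is injective (its range is exactly
the subgroup generated by `a` and `b`). -/
def IsFreeFuchsianPair (a b : PSL2R) : Prop :=
  DiscreteTopology (Subgroup.closure ({a, b} : Set PSL2R)) ∧
    Function.Injective ⇑(FreeGroup.lift (fun i : Bool => if i then a else b))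

/-- An elementary Nielsen move on a pair of elements of a group. -/
inductive NielsenStep {G : Type*} [Group G] : G × G → G × G → Prop
  | swap (a b : G) : NielsenStep (a, b) (b, a)
  | inv (a b : G) : NielsenStep (a, b) (a⁻¹, b)
  | mul (a b : G) : NielsenStep (a, b) (a, b * a)

/-- Two pairs are Nielsen equivalent if one can pass from the first to the second
by a finite sequence of elementary Nielsen moves. -/
def NielsenEquiv {G : Type*} [Group G] : G × G → G × G → Prop :=
  Relation.ReflTransGen NielsenStep

section

open Matrix Filter Topology

instance : IsTopologicalGroup SL2R := Matrix.SpecialLinearGroup.topologicalGroup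

theorem coe_inv_mul_coe (g : SL2R) : (g⁻¹).1 * g.1 = 1 := congrArg Subtype.val (inv_mul_cancel g)

theorem coe_mul_coe_inv (g : SL2R) : g.1 * (g⁻¹).1 = 1 := congrArg Subtype.val (mul_inv_cancel g)

/-- The conjugation action of `SL(2,ℝ)` on `2 × 2` matrices. -/
def conjMat (g : SL2R) (T : Matrix (Fin 2) (Fin 2) ℝ) : Matrix (Fin 2) (Fin 2) ℝ :=
  g.1 * T * (g⁻¹).1

theorem conjMat_one (T : Matrix (Fin 2) (Fin 2) ℝ) : conjMat 1 T = T := by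
  simp [conjMat]

theorem conjMat_mul (g h : SL2R) (T : Matrix (Fin 2) (Fin 2) ℝ) :
    conjMat (g * h) T = conjMat g (conjMat h T) := by
  simp only [conjMat, _root_.mul_inv_rev, Matrix.SpecialLinearGroup.coe_mul, Matrix.mul_assoc]

theorem conjMat_of_mem_center {g : SL2R} (hg : g ∈ Subgroup.center SL2R)
    (T : Matrix (Fin 2) (Fin 2) ℝ) : conjMat g T = T := by
  obtain ⟨r, hr, h⟩ := Matrix.SpecialLinearGroup.mem_center_iff.1 hg
  have h1 : g.1 * T = T * g.1 := by
    rw [← h]; exact (Matrix.scalar_commute r (fun _ => Commute.all _ _) T).eq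
  rw [conjMat, h1, Matrix.mul_assoc, coe_mul_coe_inv, Matrix.mul_one]

theorem projPSL_eq_one_iff (g : SL2R) : projPSL g = 1 ↔ g ∈ Subgroup.center SL2R :=
  QuotientGroup.eq_one_iff g

theorem continuous_conjMat (T : Matrix (Fin 2) (Fin 2) ℝ) : Continuous fun g => conjMat g T := by
  have h : Continuous fun g : SL2R => g.1 := continuous_subtype_val
  exact (h.mul continuous_const).mul (h.comp continuous_inv)

theorem continuous_projPSL : Continuous projPSL := QuotientGroup.continuous_mk

theorem isOpenMap_projPSL : IsOpenMap projPSL := QuotientGroup.isOpenMap_coe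

theorem lift_projPSL (A B : SL2R) (w : FreeGroup Bool) :
    FreeGroup.lift (fun i : Bool => if i then projPSL A else projPSL B) w =
      projPSL (FreeGroup.lift (fun i : Bool => if i then A else B) w) := by
  have : FreeGroup.lift (fun i : Bool => if i then projPSL A else projPSL B) =
      projPSL.comp (FreeGroup.lift (fun i : Bool => if i then A else B)) := by
    ext i
    cases i <;> simp
  rw [this]; rfl

theorem range_lift_eq_closure_pair {G : Type*} [Group G] (a b : G) :
    (FreeGroup.lift (fun i : Bool => if i then a else b)).range = Subgroup.closure {a, b} := by
  rw [FreeGroup.range_lift_eq_closure]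
  congr 1
  ext x
  simp [eq_comm, or_comm]

/-- Freeness and discreteness follow once an open neighbourhood of the identity, stable under
the centre, contains no nontrivial word. -/
theorem isFreeFuchsianPair_of_open (A B : SL2R) (O : Set SL2R) (hO : IsOpen O) (h1 : 1 ∈ O)
    (hc : ∀ g ∈ O, ∀ c ∈ Subgroup.center SL2R, g * c ∈ O)
    (hw : ∀ w : FreeGroup Bool, w ≠ 1 →
      FreeGroup.lift (fun i : Bool => if i then A else B) w ∉ O) :
    IsFreeFuchsianPair (projPSL A) (projPSL B) := by
  have key : ∀ w : FreeGroup Bool, ∀ g ∈ O,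
      projPSL g = projPSL (FreeGroup.lift (fun i : Bool => if i then A else B) w) → w = 1 := by
    intro w g hg h
    by_contra hne
    apply hw w hne
    have := hc g hg (g⁻¹ * FreeGroup.lift (fun i : Bool => if i then A else B) w) ?_
    · simpa using this
    · rw [← projPSL_eq_one_iff, map_mul, map_inv, h, inv_mul_cancel]
  refine ⟨?_, ?_⟩
  · refine discreteTopology_of_isOpen_singleton_one ?_
    have : ({1} : Set (Subgroup.closure ({projPSL A, projPSL B} : Set PSL2R))) =
        Subtype.val ⁻¹' (projPSL '' O) := by
      ext ⟨x, hx⟩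
      constructor
      · rintro h
        refine ⟨1, h1, ?_⟩
        rw [Set.mem_singleton_iff] at h
        rw [h]; simp
      · rintro ⟨g, hg, hgx⟩
        change projPSL g = x at hgx
        rw [← range_lift_eq_closure_pair] at hx
        obtain ⟨w, rfl⟩ := hx
        rw [lift_projPSL] at hgx
        have := key w g hg hgx
        subst this
        simp
    rw [this]
    exact (isOpenMap_projPSL O hO).preimage continuous_subtype_val
  · rw [injective_iff_map_eq_one]
    intro w h
    rw [lift_projPSL] at h
    exact key w 1 h1 (by rw [h, map_one])

theorem coe_inv_eq (g : SL2R) : (g⁻¹).1 = !![g.1 1 1, -g.1 0 1; -g.1 1 0, g.1 0 0] := by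
  rw [← adjugate_fin_two]; exact Matrix.SpecialLinearGroup.coe_inv g

theorem entry_mul_nonneg_of_trace_nonpos {E T : Matrix (Fin 2) (Fin 2) ℝ} (hE : E.trace = 0)
    (hT : T.trace = 0) (hE' : 0 ≤ E.det) (hT' : 0 < T.det) (h : (E * T).trace ≤ 0) :
    0 ≤ E 1 0 * T 1 0 ∧ E 0 1 * T 1 0 ≤ 0 := by
  simp only [trace_fin_two, det_fin_two, mul_apply, Fin.sum_univ_two] at *
  generalize E 0 0 = a at *
  generalize E 0 1 = b at *
  generalize E 1 0 = c at *
  generalize T 0 0 = p at *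
  generalize T 0 1 = q at *
  generalize T 1 0 = r at *
  rw [show E 1 1 = -a by linarith, show T 1 1 = -p by linarith] at *
  have hc : c * r * (a * p + b * r + (c * q + -a * -p)) ≤ c ^ 2 * (q * r + p ^ 2) := by
    nlinarith [sq_nonneg (a * r - c * p), mul_nonneg hE' (sq_nonneg r)]
  have hb : b * q * (a * p + b * r + (c * q + -a * -p)) ≤ b ^ 2 * (q * r + p ^ 2) := by
    nlinarith [sq_nonneg (a * q - b * p), mul_nonneg hE' (sq_nonneg q)]
  have hqr : q * r + p ^ 2 < 0 := by linarith
  constructor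
  · by_contra! hlt
    have : 0 < c ^ 2 := by
      have : c ≠ 0 := by rintro rfl; simp at hlt
      positivity
    nlinarith
  · by_contra! hlt
    have : 0 < b ^ 2 := by
      have : b ≠ 0 := by rintro rfl; simp at hlt
      positivity
    have h1 : 0 < r ^ 2 := by
      have : r ≠ 0 := by rintro rfl; simp at hlt
      positivity
    have h2 : b * q < 0 := by
      have : q * r < 0 := by nlinarith
      have h3 : (b * q) * r ^ 2 < 0 := by nlinarith
      by_contra! h4
      nlinarith
    nlinarith

theorem trace_mul_nonpos {E T : Matrix (Fin 2) (Fin 2) ℝ} (hE : E.trace = 0)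
    (hT : T.trace = 0) (hE' : 0 ≤ E.det) (hT' : 0 < T.det) {s : ℝ} (h0 : 0 < T 1 0 * s)
    (h1 : 0 ≤ E 1 0 * s) (h2 : E 0 1 * s ≤ 0) :
    (E * T).trace ≤ 0 := by
  simp only [trace_fin_two, det_fin_two, mul_apply, Fin.sum_univ_two] at *
  generalize E 0 0 = a at *
  generalize E 0 1 = b at *
  generalize E 1 0 = c at *
  generalize T 0 0 = p at *
  generalize T 0 1 = q at *
  generalize T 1 0 = r at *
  rw [show E 1 1 = -a by linarith, show T 1 1 = -p by linarith] at *
  have hc : c * r * (a * p + b * r + (c * q + -a * -p)) ≤ c ^ 2 * (q * r + p ^ 2) := by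
    nlinarith [sq_nonneg (a * r - c * p), mul_nonneg hE' (sq_nonneg r)]
  have hqr : q * r + p ^ 2 < 0 := by linarith
  have hs : 0 < s ^ 2 := by
    have : s ≠ 0 := by rintro rfl; simp at h0
    positivity
  by_cases hc0 : c = 0
  · subst hc0
    have ha : a = 0 := by nlinarith
    subst ha
    have : b * r ≤ 0 := by
      by_contra! h
      have := mul_pos h hs
      nlinarith
    linarith
  · have h3 : 0 ≤ c * r := by
      by_contra! h
      have := mul_pos (neg_pos.2 h) hs
      nlinarith
    have h4 : 0 < c * r := lt_of_le_of_ne h3 (by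
      have : r ≠ 0 := by rintro rfl; simp at h0
      positivity)
    have h5 : 0 < c ^ 2 := by positivity
    nlinarith

theorem trace_conjMat (g : SL2R) (T : Matrix (Fin 2) (Fin 2) ℝ) :
    (conjMat g T).trace = T.trace := by
  rw [conjMat, Matrix.trace_mul_comm, ← Matrix.mul_assoc, coe_inv_mul_coe, Matrix.one_mul]

theorem det_conjMat (g : SL2R) (T : Matrix (Fin 2) (Fin 2) ℝ) :
    (conjMat g T).det = T.det := by
  rw [conjMat, det_mul, det_mul, g.2, (g⁻¹).2]; ring

theorem conjMat_entry_pos (g : SL2R) {T : Matrix (Fin 2) (Fin 2) ℝ} (hT : T.trace = 0)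
    (hT' : 0 < T.det) : 0 < conjMat g T 1 0 * T 1 0 := by
  have hg := g.2
  simp only [conjMat, coe_inv_eq, trace_fin_two, det_fin_two, mul_apply, Fin.sum_univ_two,
    of_apply, cons_val_zero, cons_val_one, cons_val', cons_val_fin_one] at *
  generalize g.1 0 0 = a at *
  generalize g.1 0 1 = b at *
  generalize g.1 1 0 = c at *
  generalize g.1 1 1 = d at *
  generalize T 0 0 = p at *
  generalize T 0 1 = q at *
  generalize T 1 0 = r at *
  rw [show T 1 1 = -p by linarith] at *
  have hqr : q * r + p ^ 2 < 0 := by linarith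
  have key : ((c * p + d * r) * d + (c * q + d * -p) * -c) * r =
      (d * r + c * p) ^ 2 - c ^ 2 * (q * r + p ^ 2) := by ring
  rw [key]
  by_cases hc : c = 0
  · subst hc
    have hd : d ≠ 0 := by rintro rfl; simp at hg
    have hr : r ≠ 0 := by rintro rfl; nlinarith
    simp only [zero_mul, add_zero, ne_eq, OfNat.ofNat_ne_zero, not_false_eq_true, zero_pow,
      sub_zero]
    positivity
  · have : 0 < c ^ 2 := by positivity
    nlinarith [sq_nonneg (d * r + c * p)]

theorem trace_sq_of_trace_eq_zero {N : Matrix (Fin 2) (Fin 2) ℝ} (h : N.trace = 0) :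
    (N * N).trace = -2 * N.det := by
  simp only [trace_fin_two, det_fin_two, mul_apply, Fin.sum_univ_two] at *
  rw [show N 1 1 = -N 0 0 by linarith]
  ring

theorem trace_mul_conjMat {g : SL2R} {N N' : Matrix (Fin 2) (Fin 2) ℝ}
    (h : N * g.1 = -(g.1 * N')) (T : Matrix (Fin 2) (Fin 2) ℝ) :
    (N * conjMat g T).trace = -(N' * T).trace := by
  have : N * conjMat g T = -(g.1 * (N' * T) * (g⁻¹).1) := by
    simp only [conjMat, ← Matrix.mul_assoc, h, Matrix.neg_mul]
  rw [this, trace_neg, Matrix.trace_mul_comm, ← Matrix.mul_assoc, coe_inv_mul_coe, Matrix.one_mul]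

theorem inv_intertwine {g : SL2R} {N N' : Matrix (Fin 2) (Fin 2) ℝ}
    (h : N * g.1 = -(g.1 * N')) : N' * (g⁻¹).1 = -((g⁻¹).1 * N) := by
  have h1 : (g⁻¹).1 * (N * g.1) * (g⁻¹).1 = (g⁻¹).1 * -(g.1 * N') * (g⁻¹).1 := by rw [h]
  rw [Matrix.mul_neg, ← Matrix.mul_assoc _ g.1 N', coe_inv_mul_coe, Matrix.one_mul,
    Matrix.mul_assoc, Matrix.mul_assoc N, coe_mul_coe_inv, Matrix.mul_one, Matrix.neg_mul] at h1
  rw [h1, neg_neg]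

/-- Ping-pong in the hyperbolic plane: the traceless matrices `N x` of negative determinant define
pairwise disjoint half-planes `{T | 0 < tr (N x * T)}` among the traceless matrices `T` of positive
determinant, and the letter `x` maps the complement of the half-plane of `x⁻¹` to that of `x`. -/
theorem isFreeFuchsianPair_of_halfPlanes (A B : SL2R)
    (N : Bool × Bool → Matrix (Fin 2) (Fin 2) ℝ) (k : ℝ) (hk : 0 < k)
    (htr : ∀ x, (N x).trace = 0) (hdet : ∀ x, (N x).det = -k)
    (hN : ∀ x y, x ≠ y → (N x * N y).trace ≤ -2 * k)
    (hA : N (true, true) * A.1 = -(A.1 * N (true, false)))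
    (hB : N (false, true) * B.1 = -(B.1 * N (false, false))) :
    IsFreeFuchsianPair (projPSL A) (projPSL B) := by
  set f : Bool → SL2R := fun i => if i then A else B with hf
  have hsq : ∀ x, (N x * N x).trace = 2 * k := fun x => by
    rw [trace_sq_of_trace_eq_zero (htr x), hdet]; ring
  have hletter : ∀ (x : Bool × Bool) (T : Matrix (Fin 2) (Fin 2) ℝ),
      (N x * conjMat (cond x.2 (f x.1) (f x.1)⁻¹) T).trace = -(N (x.1, !x.2) * T).trace := by
    rintro ⟨i, s⟩ T
    apply trace_mul_conjMat
    cases i <;> cases s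
    · exact inv_intertwine hB
    · exact hB
    · exact inv_intertwine hA
    · exact hA
  set T₀ := N (true, true) + N (true, false) + N (false, true) + N (false, false) with hT₀
  have hT₀tr : T₀.trace = 0 := by simp [hT₀, trace_add, htr]
  have hNT : ∀ x, (N x * T₀).trace ≤ -4 * k := by
    rintro ⟨i, s⟩
    simp only [hT₀, Matrix.mul_add, trace_add]
    cases i <;> cases s
    · have h1 := hN (false, false) (true, true) (by decide)
      have h2 := hN (false, false) (true, false) (by decide)
      have h3 := hN (false, false) (false, true) (by decide)
      linarith [hsq (false, false)]
    · have h1 := hN (false, true) (true, true) (by decide)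
      have h2 := hN (false, true) (true, false) (by decide)
      have h3 := hN (false, true) (false, false) (by decide)
      linarith [hsq (false, true)]
    · have h1 := hN (true, false) (true, true) (by decide)
      have h2 := hN (true, false) (false, true) (by decide)
      have h3 := hN (true, false) (false, false) (by decide)
      linarith [hsq (true, false)]
    · have h1 := hN (true, true) (true, false) (by decide)
      have h2 := hN (true, true) (false, true) (by decide)
      have h3 := hN (true, true) (false, false) (by decide)
      linarith [hsq (true, true)]
  have hT₀det : 0 < T₀.det := by
    have h := trace_sq_of_trace_eq_zero hT₀tr
    have h' : (T₀ * T₀).trace = (N (true, true) * T₀).trace + (N (true, false) * T₀).trace +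
        (N (false, true) * T₀).trace + (N (false, false) * T₀).trace := by
      simp only [← trace_add, ← Matrix.add_mul]; rfl
    linarith [hNT (true, true), hNT (true, false), hNT (false, true), hNT (false, false)]
  have hdisj : ∀ (g : SL2R) (x y : Bool × Bool), x ≠ y → 0 < (N x * conjMat g T₀).trace →
      (N y * conjMat g T₀).trace < 0 := by
    intro g x y hxy h
    have hE : (N x + N y).trace = 0 := by rw [trace_add, htr, htr, add_zero]
    have hEdet : 0 ≤ (N x + N y).det := by
      have h1 := trace_sq_of_trace_eq_zero hE
      simp only [Matrix.mul_add, Matrix.add_mul, trace_add, hsq, Matrix.trace_mul_comm (N y)] at h1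
      linarith [hN x y hxy]
    obtain ⟨h1, h2⟩ := entry_mul_nonneg_of_trace_nonpos hE hT₀tr hEdet hT₀det (by
      rw [Matrix.add_mul, trace_add]; linarith [hNT x, hNT y])
    have h3 := trace_mul_nonpos hE (T := conjMat g T₀) (by rw [trace_conjMat, hT₀tr]) hEdet
      (by rw [det_conjMat]; exact hT₀det) (conjMat_entry_pos g hT₀tr hT₀det) h1 h2
    rw [Matrix.add_mul, trace_add] at h3
    linarith
  have hpp : ∀ (L : List (Bool × Bool)) (x : Bool × Bool), FreeGroup.IsReduced (x :: L) →
      0 < (N x * conjMat (((x :: L).map fun x => cond x.2 (f x.1) (f x.1)⁻¹).prod) T₀).trace := by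
    intro L
    induction L with
    | nil =>
      intro x _
      simp only [List.map_cons, List.map_nil, List.prod_cons, List.prod_nil, mul_one, hletter]
      linarith [hNT (x.1, !x.2)]
    | cons y L ih =>
      intro x hx
      rw [FreeGroup.isReduced_cons_cons] at hx
      have h1 := ih y hx.2
      rw [List.map_cons, List.prod_cons, conjMat_mul, hletter]
      have h2 := hdisj _ y (x.1, !x.2) (by
        rintro rfl
        have := hx.1 rfl
        simp at this) h1
      linarith
  refine isFreeFuchsianPair_of_open A B {g | ∀ x, (N x * conjMat g T₀).trace < 0} ?_ ?_ ?_ ?_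
  · have : {g : SL2R | ∀ x, (N x * conjMat g T₀).trace < 0} =
        ⋂ x, {g | (N x * conjMat g T₀).trace < 0} := by ext; simp
    rw [this]
    refine isOpen_iInter_of_finite fun x => isOpen_lt ?_ continuous_const
    exact (continuous_const.mul (continuous_conjMat T₀)).matrix_trace
  · intro x
    rw [conjMat_one]
    linarith [hNT x]
  · intro g hg c hc x
    rw [conjMat_mul, conjMat_of_mem_center hc]
    exact hg x
  · intro w hw hmem
    have hne : w.toWord ≠ [] := fun h => hw (FreeGroup.toWord_eq_nil_iff.1 h)
    have hred := FreeGroup.isReduced_toWord (x := w)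
    rw [← FreeGroup.mk_toWord (x := w), FreeGroup.lift_mk] at hmem
    cases h : w.toWord with
    | nil => exact hne h
    | cons x L =>
      rw [h] at hmem hred
      exact absurd (hmem x) (not_lt.2 (hpp L x hred).le)

theorem isFreeFuchsianPair_of_four_halfPlanes (A B : SL2R)
    (P P' Q Q' : Matrix (Fin 2) (Fin 2) ℝ) (k : ℝ) (hk : 0 < k)
    (htr : P.trace = 0 ∧ P'.trace = 0 ∧ Q.trace = 0 ∧ Q'.trace = 0)
    (hdet : P.det = -k ∧ P'.det = -k ∧ Q.det = -k ∧ Q'.det = -k)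
    (hPP' : (P * P').trace ≤ -2 * k) (hQQ' : (Q * Q').trace ≤ -2 * k)
    (hPQ : (P * Q).trace ≤ -2 * k) (hPQ' : (P * Q').trace ≤ -2 * k)
    (hP'Q : (P' * Q).trace ≤ -2 * k) (hP'Q' : (P' * Q').trace ≤ -2 * k)
    (hA : P * A.1 = -(A.1 * P')) (hB : Q * B.1 = -(B.1 * Q')) :
    IsFreeFuchsianPair (projPSL A) (projPSL B) := by
  obtain ⟨t1, t2, t3, t4⟩ := htr
  obtain ⟨d1, d2, d3, d4⟩ := hdet
  have c1 := hPP'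
  have c2 := hQQ'
  have c3 := hPQ
  have c4 := hPQ'
  have c5 := hP'Q
  have c6 := hP'Q'
  rw [Matrix.trace_mul_comm] at c1 c2 c3 c4 c5 c6
  refine isFreeFuchsianPair_of_halfPlanes A B
    (fun x => if x.1 then (if x.2 then P else P') else (if x.2 then Q else Q')) k hk ?_ ?_ ?_ hA hB
  · rintro ⟨i, s⟩
    cases i <;> cases s <;> assumption
  · rintro ⟨i, s⟩
    cases i <;> cases s <;> assumption
  · rintro ⟨i, s⟩ ⟨j, t⟩ h
    cases i <;> cases s <;> cases j <;> cases t <;> first | assumption | exact absurd rfl h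

theorem trSL_commutator (A B : SL2R) :
    trSL (A * B * A⁻¹ * B⁻¹) = trSL A ^ 2 + trSL B ^ 2 + trSL (A * B) ^ 2 -
      trSL A * trSL B * trSL (A * B) - 2 := by
  have key : (A.1 * B.1 * (A⁻¹).1 * (B⁻¹).1).trace =
      A.1.trace ^ 2 * B.1.det + B.1.trace ^ 2 * A.1.det + (A.1 * B.1).trace ^ 2 -
        A.1.trace * B.1.trace * (A.1 * B.1).trace - 2 * A.1.det * B.1.det := by
    simp only [coe_inv_eq, trace_fin_two, det_fin_two, mul_apply, Fin.sum_univ_two,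
      of_apply, cons_val_zero, cons_val_one, cons_val', cons_val_fin_one]
    ring
  rw [A.2, B.2] at key
  simp only [trSL, Matrix.SpecialLinearGroup.coe_mul]
  linarith

theorem trSL_mul_inv (A B : SL2R) :
    trSL (A * B⁻¹) = trSL A * trSL B - trSL (A * B) := by
  simp only [trSL, Matrix.SpecialLinearGroup.coe_mul, coe_inv_eq, trace_fin_two, mul_apply,
    Fin.sum_univ_two, of_apply, cons_val_zero, cons_val_one, cons_val', cons_val_fin_one]
  ring

theorem eighteen_le_trSL_commutator {U V : SL2R} (hU : 2 ≤ trSL U) (hV : 2 ≤ trSL V)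
    (hUV : trSL (U * V) ≤ -2) : 18 ≤ trSL (U * V * U⁻¹ * V⁻¹) := by
  rw [trSL_commutator]
  have h : 2 * 2 ≤ trSL U * trSL V := by gcongr
  nlinarith

theorem trace_half_mul_neg_half {U L : Matrix (Fin 2) (Fin 2) ℝ} (hL : L.trace = 0) :
    (U * L * -(L * U)).trace = L.det * (U.trace ^ 2 - 2 * U.det) := by
  simp only [trace_fin_two, det_fin_two, mul_apply, Fin.sum_univ_two, Matrix.neg_apply] at *
  rw [show L 1 1 = -L 0 0 by linarith]
  ring

theorem trace_half_mul_half {U V L : Matrix (Fin 2) (Fin 2) ℝ} (hL : L.trace = 0) :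
    (U * L * (L * V)).trace = -L.det * (U * V).trace := by
  simp only [trace_fin_two, det_fin_two, mul_apply, Fin.sum_univ_two] at *
  rw [show L 1 1 = -L 0 0 by linarith]
  ring

theorem trace_bracket (U V : Matrix (Fin 2) (Fin 2) ℝ) : (U * V - V * U).trace = 0 := by
  rw [trace_sub, Matrix.trace_mul_comm, sub_self]

theorem trace_mul_bracket (U V : Matrix (Fin 2) (Fin 2) ℝ) :
    (U * (U * V - V * U)).trace = 0 := by
  rw [Matrix.mul_sub, trace_sub, ← Matrix.mul_assoc, ← Matrix.mul_assoc,
    Matrix.trace_mul_comm (U * V), ← Matrix.mul_assoc, sub_self]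

theorem trace_bracket_mul (U V : Matrix (Fin 2) (Fin 2) ℝ) :
    ((U * V - V * U) * V).trace = 0 := by
  rw [Matrix.trace_mul_comm, ← neg_sub, Matrix.mul_neg, trace_neg, trace_mul_bracket, neg_zero]

theorem det_bracket (U V : Matrix (Fin 2) (Fin 2) ℝ) :
    (U * V - V * U).det = -(U.trace ^ 2 * V.det + V.trace ^ 2 * U.det + (U * V).trace ^ 2 -
      U.trace * V.trace * (U * V).trace - 4 * U.det * V.det) := by
  simp only [trace_fin_two, det_fin_two, mul_apply, Fin.sum_univ_two, Matrix.sub_apply]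
  ring

theorem trace_mul_bracket_mul_mul_bracket (U V : Matrix (Fin 2) (Fin 2) ℝ) :
    (U * (U * V - V * U) * (V * (U * V - V * U))).trace =
      -(U * V - V * U).det * (U.trace * V.trace - (U * V).trace) := by
  simp only [trace_fin_two, det_fin_two, mul_apply, Fin.sum_univ_two, Matrix.sub_apply]
  ring

theorem trace_bracket_mul_mul_bracket_mul (U V : Matrix (Fin 2) (Fin 2) ℝ) :
    ((U * V - V * U) * U * ((U * V - V * U) * V)).trace =
      -(U * V - V * U).det * (U.trace * V.trace - (U * V).trace) := by
  simp only [trace_fin_two, det_fin_two, mul_apply, Fin.sum_univ_two, Matrix.sub_apply]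
  ring

/-- A pair of pants: two hyperbolic or parabolic elements whose product has trace at most `-2`. -/
theorem isFreeFuchsianPair_of_trSL_mul_le {U V : SL2R} (hU : 2 ≤ trSL U) (hV : 2 ≤ trSL V)
    (hUV : trSL (U * V) ≤ -2) : IsFreeFuchsianPair (projPSL U) (projPSL V) := by
  have h18 := eighteen_le_trSL_commutator hU hV hUV
  rw [trSL_commutator] at h18
  change 2 ≤ U.1.trace at hU
  change 2 ≤ V.1.trace at hV
  change (U.1 * V.1).trace ≤ -2 at hUV
  have h18 : 18 ≤ U.1.trace ^ 2 + V.1.trace ^ 2 + (U.1 * V.1).trace ^ 2 -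
      U.1.trace * V.1.trace * (U.1 * V.1).trace - 2 := h18
  have hdU : U.1.det = 1 := U.2
  have hdV : V.1.det = 1 := V.2
  have hL := trace_bracket U.1 V.1
  have hUL := trace_mul_bracket U.1 V.1
  have hLV := trace_bracket_mul U.1 V.1
  have hdet := det_bracket U.1 V.1
  have e3 := trace_mul_bracket_mul_mul_bracket U.1 V.1
  have e6 := trace_bracket_mul_mul_bracket_mul U.1 V.1
  have hUU : 2 * 2 ≤ U.1.trace ^ 2 := by rw [sq]; gcongr
  have hVV : 2 * 2 ≤ V.1.trace ^ 2 := by rw [sq]; gcongr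
  have hxy : 2 * 2 ≤ U.1.trace * V.1.trace := by gcongr
  rw [hdU, hdV] at hdet
  obtain ⟨n, hn⟩ : ∃ n, (U.1 * V.1 - V.1 * U.1).det = -n := ⟨_, (neg_neg _).symm⟩
  have hn0 : 0 < n := by linarith
  rw [hn, neg_neg] at e3 e6
  generalize U.1 * V.1 - V.1 * U.1 = L at *
  have hVL : (V.1 * L).trace = 0 := by rw [Matrix.trace_mul_comm, hLV]
  have hLU : (L * U.1).trace = 0 := by rw [Matrix.trace_mul_comm, hUL]
  refine isFreeFuchsianPair_of_four_halfPlanes U V (U.1 * L) (-(L * U.1)) (-(V.1 * L)) (L * V.1)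
    n hn0 ⟨hUL, by rw [trace_neg, hLU, neg_zero], by rw [trace_neg, hVL, neg_zero], hLV⟩
    ⟨?_, ?_, ?_, ?_⟩ ?_ ?_ ?_ ?_ ?_ ?_ ?_ ?_
  iterate 4
    simp [det_neg, det_mul, hdU, hdV, hn]
  · rw [trace_half_mul_neg_half hL, hn, hdU]
    linarith [mul_nonneg hn0.le (sub_nonneg.2 hUU)]
  · rw [Matrix.neg_mul, ← Matrix.mul_neg, trace_half_mul_neg_half hL, hn, hdV]
    linarith [mul_nonneg hn0.le (sub_nonneg.2 hVV)]
  · rw [Matrix.mul_neg, trace_neg, e3]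
    linarith [mul_nonneg hn0.le (sub_nonneg.2 hxy), mul_nonneg hn0.le (sub_nonneg.2 hUV)]
  · rw [trace_half_mul_half hL, hn]
    linarith [mul_nonneg hn0.le (sub_nonneg.2 hUV)]
  · rw [Matrix.neg_mul, Matrix.mul_neg, neg_neg, Matrix.trace_mul_comm, trace_half_mul_half hL, hn,
      Matrix.trace_mul_comm V.1]
    linarith [mul_nonneg hn0.le (sub_nonneg.2 hUV)]
  · rw [Matrix.neg_mul, trace_neg, e6]
    linarith [mul_nonneg hn0.le (sub_nonneg.2 hxy), mul_nonneg hn0.le (sub_nonneg.2 hUV)]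
  · rw [Matrix.mul_neg, neg_neg, Matrix.mul_assoc]
  · rw [Matrix.neg_mul, Matrix.mul_assoc]

/-- `tr (A * adj B) - tr A * adj B`, the factor `H` for which `A * H` and `H * A` are the traceless
matrices of the geodesics bounding the fundamental domain of a one-holed torus. -/
noncomputable def torusFactor (A B : Matrix (Fin 2) (Fin 2) ℝ) : Matrix (Fin 2) (Fin 2) ℝ :=
  (A * B.adjugate).trace • 1 - A.trace • B.adjugate

theorem trace_mul_torusFactor (A B : Matrix (Fin 2) (Fin 2) ℝ) :
    (A * torusFactor A B).trace = 0 := by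
  simp [torusFactor, Matrix.mul_sub, mul_comm]

theorem det_torusFactor (A B : Matrix (Fin 2) (Fin 2) ℝ) :
    (torusFactor A B).det = (A * B.adjugate).trace ^ 2 -
      A.trace * B.trace * (A * B.adjugate).trace + A.trace ^ 2 * B.det := by
  simp [torusFactor, trace_fin_two, det_fin_two, mul_apply, Fin.sum_univ_two, adjugate_fin_two]
  ring

theorem trace_mul_torusFactor_mul_self (A B : Matrix (Fin 2) (Fin 2) ℝ) :
    (A * torusFactor A B * (torusFactor A B * A)).trace =
      -((2 * (A * B.adjugate).trace - A.trace * B.trace) ^ 2 * A.det +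
        (torusFactor A B).det * (A.trace ^ 2 - 2 * A.det)) := by
  simp [torusFactor, trace_fin_two, det_fin_two, mul_apply, Fin.sum_univ_two, adjugate_fin_two]
  ring

theorem trace_mul_torusFactor_mul_mul_torusFactor (A B : Matrix (Fin 2) (Fin 2) ℝ) :
    (A * torusFactor A B * (B * torusFactor B A)).trace =
      (A * B.adjugate).trace ^ 2 * (A.trace * B.trace - (A * B.adjugate).trace) -
      (A * B.adjugate).trace * (A.trace ^ 2 * B.det + B.trace ^ 2 * A.det) +
      2 * A.trace * B.trace * A.det * B.det := by
  simp [torusFactor, trace_fin_two, det_fin_two, mul_apply, Fin.sum_univ_two, adjugate_fin_two]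
  ring

theorem trace_mul_torusFactor_mul_torusFactor_mul (A B : Matrix (Fin 2) (Fin 2) ℝ) :
    (A * torusFactor A B * (torusFactor B A * B)).trace =
      (A * B.adjugate).trace ^ 2 * (A.trace * B.trace - (A * B.adjugate).trace) -
      (A * B.adjugate).trace * (A.trace ^ 2 * B.det + B.trace ^ 2 * A.det) +
      A.trace * B.trace * (A.trace ^ 2 * B.det + B.trace ^ 2 * A.det +
        (A * B.adjugate).trace ^ 2 - A.trace * B.trace * (A * B.adjugate).trace -
        2 * A.det * B.det) := by
  simp [torusFactor, trace_fin_two, det_fin_two, mul_apply, Fin.sum_univ_two, adjugate_fin_two]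
  ring

theorem trace_torusFactor_mul_mul_torusFactor_mul (A B : Matrix (Fin 2) (Fin 2) ℝ) :
    (torusFactor A B * A * (torusFactor B A * B)).trace =
      (A * torusFactor A B * (B * torusFactor B A)).trace := by
  simp [torusFactor, trace_fin_two, mul_apply, Fin.sum_univ_two, adjugate_fin_two]
  ring

theorem trace_mul_adjugate_comm (A B : Matrix (Fin 2) (Fin 2) ℝ) :
    (B * A.adjugate).trace = (A * B.adjugate).trace := by
  simp [trace_fin_two, mul_apply, Fin.sum_univ_two, adjugate_fin_two]
  ring

/-- A one-holed torus, in the normalisation where both generators have positive trace. -/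
theorem isFreeFuchsianPair_of_trSL_commutator_le_of_pos {A B : SL2R} (hA : 0 < trSL A)
    (hB : 0 < trSL B) (hAB : trSL (A * B * A⁻¹ * B⁻¹) ≤ -2) :
    IsFreeFuchsianPair (projPSL A) (projPSL B) := by
  have ht := trSL_mul_inv A B
  rw [trSL_commutator] at hAB
  set x := trSL A with hx
  set y := trSL B with hy
  set t := trSL (A * B⁻¹) with htt
  have hz : trSL (A * B) = x * y - t := by linarith
  rw [hz] at hAB
  have hdA : A.1.det = 1 := A.2
  have hdB : B.1.det = 1 := B.2
  have hxA : x = A.1.trace := rfl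
  have hyB : y = B.1.trace := rfl
  have htAB : t = (A.1 * B.1.adjugate).trace := rfl
  have ht0 : 0 < t := by
    have : 0 < x * y := mul_pos hA hB
    by_contra! h
    nlinarith [mul_nonneg this.le (neg_nonneg.2 h), mul_self_nonneg t, mul_pos hA hA]
  have hz0 : 0 < x * y - t := by
    have : 0 < x * y := mul_pos hA hB
    by_contra! h
    nlinarith [mul_nonneg this.le (neg_nonneg.2 h), mul_self_nonneg (x * y - t), mul_pos hA hA]
  set D := x * y * t - x ^ 2 - y ^ 2 - t ^ 2 with hD
  have hD0 : 0 ≤ D := by nlinarith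
  have hka : 0 < x * y * t - x ^ 2 - t ^ 2 := by nlinarith
  have hkb : 0 < x * y * t - y ^ 2 - t ^ 2 := by nlinarith
  set ka := x * y * t - x ^ 2 - t ^ 2 with hkadef
  set kb := x * y * t - y ^ 2 - t ^ 2 with hkbdef
  set α := √kb with hα
  set β := √ka with hβ
  have hα2 : α ^ 2 = kb := Real.sq_sqrt hkb.le
  have hβ2 : β ^ 2 = ka := Real.sq_sqrt hka.le
  have hα0 : 0 < α := Real.sqrt_pos.2 hkb
  have hβ0 : 0 < β := Real.sqrt_pos.2 hka
  have hcross : ∀ u, 0 < u → D = x * y * u - x ^ 2 - y ^ 2 - u ^ 2 →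
      α * β * -(u * D + 2 * x * y) ≤ -2 * (ka * kb) := by
    intro u hu h
    have h1 : α * β ≤ (u * D + 2 * x * y) / 2 := by
      refine abs_le_of_sq_le_sq' ?_ (by positivity) |>.2
      have key : ((u * D + 2 * x * y) / 2) ^ 2 =
          (y ^ 2 + D) * (x ^ 2 + D) + D * (u ^ 2 * (D + 4) / 4) := by
        linear_combination (-D) * h
      have hpos : 0 ≤ D * (u ^ 2 * (D + 4) / 4) := by positivity
      rw [mul_pow, hα2, hβ2, key, show ka = y ^ 2 + D by ring, show kb = x ^ 2 + D by ring]
      linarith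
    have h2 : α * β * (α * β) = ka * kb := by rw [← hα2, ← hβ2]; ring
    linarith [mul_le_mul_of_nonneg_left h1 (mul_pos hα0 hβ0).le]
  have hcross₁ := hcross t ht0 rfl
  have hcross₂ := hcross (x * y - t) hz0 (by rw [hD]; ring)
  have eA := trace_mul_torusFactor A.1 B.1
  have eB := trace_mul_torusFactor B.1 A.1
  have dH := det_torusFactor A.1 B.1
  have dK := det_torusFactor B.1 A.1
  have eP := trace_mul_torusFactor_mul_self A.1 B.1
  have eQ := trace_mul_torusFactor_mul_self B.1 A.1
  have e1 := trace_mul_torusFactor_mul_mul_torusFactor A.1 B.1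
  have e2 := trace_torusFactor_mul_mul_torusFactor_mul A.1 B.1
  have e3 := trace_mul_torusFactor_mul_torusFactor_mul A.1 B.1
  have e4 := trace_mul_torusFactor_mul_torusFactor_mul B.1 A.1
  rw [trace_mul_adjugate_comm, ← hxA, ← hyB, ← htAB, hdA] at dK
  rw [← hxA, ← hyB, ← htAB, hdB] at dH
  rw [← hxA, ← hyB, ← htAB, dH, hdA] at eP
  rw [trace_mul_adjugate_comm, ← hxA, ← hyB, ← htAB, dK, hdB] at eQ
  rw [e1] at e2
  rw [← hxA, ← hyB, ← htAB, hdA, hdB] at e1 e2 e3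
  rw [trace_mul_adjugate_comm, ← hxA, ← hyB, ← htAB, hdA, hdB] at e4
  generalize torusFactor A.1 B.1 = H at *
  generalize torusFactor B.1 A.1 = K at *
  have eA' : (H * A.1).trace = 0 := by rw [Matrix.trace_mul_comm, eA]
  have eB' : (K * B.1).trace = 0 := by rw [Matrix.trace_mul_comm, eB]
  refine isFreeFuchsianPair_of_four_halfPlanes A B (α • (A.1 * H)) (-(α • (H * A.1)))
    (-(β • (B.1 * K))) (β • (K * B.1)) (ka * kb) (mul_pos hka hkb)
    ⟨?_, ?_, ?_, ?_⟩ ⟨?_, ?_, ?_, ?_⟩ ?_ ?_ ?_ ?_ ?_ ?_ ?_ ?_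
  iterate 4
    simp [eA, eB, eA', eB']
  iterate 2
    simp only [det_neg, det_smul, det_mul, hdA, dH, Fintype.card_fin, hα2]
    rw [hkadef]; ring
  iterate 2
    simp only [det_neg, det_smul, det_mul, hdB, dK, Fintype.card_fin, hβ2]
    rw [hkbdef]; ring
  all_goals simp only [Matrix.neg_mul, Matrix.mul_neg, Matrix.smul_mul, Matrix.mul_smul, trace_neg,
    trace_smul, smul_smul, smul_eq_mul, eP, eQ]
  · have h := mul_nonneg hkb.le (mul_nonneg (sq_nonneg x) (by positivity : 0 ≤ D + 4))
    rw [← sq, hα2]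
    linear_combination h
  · have h := mul_nonneg hka.le (mul_nonneg (sq_nonneg y) (by positivity : 0 ≤ D + 4))
    linear_combination h +
      ((2 * t - y * x) ^ 2 + (t ^ 2 - y * x * t + y ^ 2) * (y ^ 2 - 2)) * hβ2
  · rw [e1]
    linear_combination hcross₁
  · rw [e3]
    linear_combination hcross₂
  · rw [Matrix.trace_mul_comm, e4]
    linear_combination hcross₂
  · rw [e2]
    linear_combination hcross₁
  · rw [Matrix.mul_assoc, neg_neg]
  · rw [Matrix.mul_assoc]

theorem trSL_neg (A : SL2R) : trSL (-A) = -trSL A := by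
  simp [trSL]

theorem projPSL_neg (A : SL2R) : projPSL (-A) = projPSL A := by
  have h : (-1 : SL2R) ∈ Subgroup.center SL2R :=
    Subgroup.mem_center_iff.2 fun g => by rw [mul_neg, neg_mul, mul_one, one_mul]
  rw [show -A = A * -1 by rw [mul_neg, mul_one], map_mul, (projPSL_eq_one_iff _).2 h, mul_one]

theorem trSL_inv (A : SL2R) : trSL A⁻¹ = trSL A := by
  rw [trSL, coe_inv_eq, trace_fin_two_of, add_comm, ← trace_fin_two]
  rfl

theorem trSL_mul_comm (A B : SL2R) : trSL (A * B) = trSL (B * A) :=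
  Matrix.trace_mul_comm _ _

/-- `SL(2,ℝ)` contains no copy of the quaternion group. -/
theorem trSL_ne_zero_of_mul {A B : SL2R} (hA : trSL A = 0) (hB : trSL B = 0) :
    trSL (A * B) ≠ 0 := by
  intro h
  have hdA : A.1.det = 1 := A.2
  have hdB : B.1.det = 1 := B.2
  change A.1.trace = 0 at hA
  change B.1.trace = 0 at hB
  change (A.1 * B.1).trace = 0 at h
  simp only [trace_fin_two, det_fin_two, mul_apply, Fin.sum_univ_two] at *
  generalize A.1 0 0 = a at *
  generalize A.1 0 1 = b at *
  generalize A.1 1 0 = c at *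
  generalize B.1 0 0 = p at *
  generalize B.1 0 1 = q at *
  generalize B.1 1 0 = r at *
  rw [show A.1 1 1 = -a by linarith, show B.1 1 1 = -p by linarith] at *
  have key : (a * r - c * p) ^ 2 + r ^ 2 + c ^ 2 = 0 := by
    linear_combination (-c * r) * h - r ^ 2 * hdA - c ^ 2 * hdB
  have hc : c = 0 := by nlinarith [sq_nonneg (a * r - c * p), sq_nonneg r, sq_nonneg c]
  rw [hc] at hdA
  nlinarith [sq_nonneg a]

theorem trSL_commutator_neg_left (A B : SL2R) :
    trSL (-A * B * (-A)⁻¹ * B⁻¹) = trSL (A * B * A⁻¹ * B⁻¹) := by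
  rw [inv_neg]; simp

theorem trSL_commutator_neg_right (A B : SL2R) :
    trSL (A * -B * A⁻¹ * (-B)⁻¹) = trSL (A * B * A⁻¹ * B⁻¹) := by
  rw [inv_neg]; simp

/-- A one-holed torus. -/
theorem isFreeFuchsianPair_of_trSL_commutator_le {A B : SL2R}
    (h : trSL (A * B * A⁻¹ * B⁻¹) ≤ -2) : IsFreeFuchsianPair (projPSL A) (projPSL B) := by
  have hne : trSL A ≠ 0 ∧ trSL B ≠ 0 := by
    have h' := h
    rw [trSL_commutator] at h'
    constructor
    · intro h0
      rw [h0] at h'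
      refine trSL_ne_zero_of_mul (B := B) h0 (pow_eq_zero_iff two_ne_zero |>.1 ?_)
        (pow_eq_zero_iff two_ne_zero |>.1 ?_) <;>
      nlinarith [sq_nonneg (trSL B), sq_nonneg (trSL (A * B))]
    · intro h0
      rw [h0] at h'
      refine trSL_ne_zero_of_mul (A := A) (pow_eq_zero_iff two_ne_zero |>.1 ?_) h0
        (pow_eq_zero_iff two_ne_zero |>.1 ?_) <;>
      nlinarith [sq_nonneg (trSL A), sq_nonneg (trSL (A * B))]
  wlog hA : 0 < trSL A generalizing A
  · rw [← projPSL_neg A]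
    refine this (by rwa [trSL_commutator_neg_left]) ?_ ?_
    · rw [trSL_neg, neg_ne_zero]; exact hne
    · rw [trSL_neg]; linarith [lt_of_le_of_ne (not_lt.1 hA) hne.1]
  wlog hB : 0 < trSL B generalizing B
  · rw [← projPSL_neg B]
    refine this (by rwa [trSL_commutator_neg_right]) ?_ ?_
    · rw [trSL_neg, neg_ne_zero]; exact hne
    · rw [trSL_neg]; linarith [lt_of_le_of_ne (not_lt.1 hB) hne.2]
  exact isFreeFuchsianPair_of_trSL_commutator_le_of_pos hA hB h

theorem NielsenStep.symm {G : Type*} [Group G] {p q : G × G} (h : NielsenStep p q) :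
    NielsenEquiv q p := by
  cases h with
  | swap a b => exact .single (.swap b a)
  | inv a b => exact .single (by simpa using NielsenStep.inv a⁻¹ b)
  | mul a b =>
    refine .head (.inv a (b * a)) (.head (.mul a⁻¹ (b * a)) ?_)
    rw [mul_inv_cancel_right]
    exact .single (by simpa using NielsenStep.inv a⁻¹ b)

theorem NielsenEquiv.symm {G : Type*} [Group G] {p q : G × G} (h : NielsenEquiv p q) :
    NielsenEquiv q p := by
  induction h with
  | refl => exact .refl
  | tail _ h ih => exact Relation.ReflTransGen.trans h.symm ih

theorem NielsenStep.closure_le {G : Type*} [Group G] {p q : G × G} (h : NielsenStep p q) :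
    Subgroup.closure {q.1, q.2} ≤ Subgroup.closure {p.1, p.2} := by
  have h1 : p.1 ∈ Subgroup.closure {p.1, p.2} := Subgroup.subset_closure (by simp)
  have h2 : p.2 ∈ Subgroup.closure {p.1, p.2} := Subgroup.subset_closure (by simp)
  rw [Subgroup.closure_le, Set.insert_subset_iff, Set.singleton_subset_iff]
  cases h with
  | swap a b => exact ⟨h2, h1⟩
  | inv a b => exact ⟨inv_mem h1, h2⟩
  | mul a b => exact ⟨h1, mul_mem h2 h1⟩

theorem NielsenStep.exists_lift_eq {G : Type*} [Group G] {p q : G × G} (h : NielsenStep p q) :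
    ∃ φ : FreeGroup Bool →* FreeGroup Bool, Function.Injective φ ∧
      FreeGroup.lift (fun i : Bool => if i then q.1 else q.2) =
        (FreeGroup.lift (fun i : Bool => if i then p.1 else p.2)).comp φ := by
  have key : ∀ φ ψ : FreeGroup Bool →* FreeGroup Bool, ψ.comp φ = MonoidHom.id _ →
      Function.Injective φ := fun φ ψ h =>
    Function.LeftInverse.injective (g := ψ) fun w => DFunLike.congr_fun h w
  cases h with
  | swap a b =>
    refine ⟨FreeGroup.lift (fun i : Bool => FreeGroup.of !i),
      key _ (FreeGroup.lift (fun i : Bool => FreeGroup.of !i)) ?_, ?_⟩ <;>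
    ext i <;> cases i <;> simp
  | inv a b =>
    refine ⟨FreeGroup.lift
        (fun i : Bool => if i then (FreeGroup.of true)⁻¹ else FreeGroup.of false),
      key _ (FreeGroup.lift
        (fun i : Bool => if i then (FreeGroup.of true)⁻¹ else FreeGroup.of false)) ?_, ?_⟩ <;>
    ext i <;> cases i <;> simp
  | mul a b =>
    refine ⟨FreeGroup.lift (fun i : Bool =>
        if i then FreeGroup.of true else FreeGroup.of false * FreeGroup.of true),
      key _ (FreeGroup.lift (fun i : Bool =>
        if i then FreeGroup.of true else FreeGroup.of false * (FreeGroup.of true)⁻¹)) ?_, ?_⟩ <;>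
    ext i <;> cases i <;> simp

theorem IsFreeFuchsianPair.of_nielsenStep {p q : PSL2R × PSL2R}
    (hp : IsFreeFuchsianPair p.1 p.2) (h : NielsenStep p q) : IsFreeFuchsianPair q.1 q.2 := by
  obtain ⟨φ, hφ, e⟩ := h.exists_lift_eq
  refine ⟨DiscreteTopology.of_subset hp.1 h.closure_le, ?_⟩
  rw [e]
  exact hp.2.comp hφ

theorem IsFreeFuchsianPair.of_nielsenEquiv_pair {p q : PSL2R × PSL2R}
    (hp : IsFreeFuchsianPair p.1 p.2) (e : NielsenEquiv p q) : IsFreeFuchsianPair q.1 q.2 := by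
  induction e with
  | refl => exact hp
  | tail _ e ih => exact ih.of_nielsenStep e

theorem IsFreeFuchsianPair.of_nielsenEquiv {a b c d : PSL2R} (h : IsFreeFuchsianPair a b)
    (e : NielsenEquiv (a, b) (c, d)) : IsFreeFuchsianPair c d :=
  of_nielsenEquiv_pair (p := (a, b)) (q := (c, d)) h e

theorem commutator_mul_of_mem_center {G : Type*} [Group G] {c d : G} (hc : c ∈ Subgroup.center G)
    (hd : d ∈ Subgroup.center G) (a b : G) :
    a * c * (b * d) * (a * c)⁻¹ * (b * d)⁻¹ = a * b * a⁻¹ * b⁻¹ := by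
  have h1 : a * c * (b * d) = a * b * d * c := by
    rw [mul_assoc a, ← Subgroup.mem_center_iff.1 hc (b * d)]; simp only [mul_assoc]
  have h2 : d * a⁻¹ = a⁻¹ * d := (Subgroup.mem_center_iff.1 hd a⁻¹).symm
  calc a * c * (b * d) * (a * c)⁻¹ * (b * d)⁻¹ = a * b * (d * a⁻¹) * d⁻¹ * b⁻¹ := by
        rw [h1]; group
    _ = a * b * a⁻¹ * b⁻¹ := by rw [h2]; group

theorem commutator_eq_of_projPSL_eq {A B A' B' : SL2R} (hA : projPSL A = projPSL A')
    (hB : projPSL B = projPSL B') : A' * B' * A'⁻¹ * B'⁻¹ = A * B * A⁻¹ * B⁻¹ := by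
  have := commutator_mul_of_mem_center (c := A⁻¹ * A') (d := B⁻¹ * B')
    ((projPSL_eq_one_iff _).1 (by simp [hA])) ((projPSL_eq_one_iff _).1 (by simp [hB])) A B
  simpa using this

theorem NielsenStep.trSL_commutator_eq {p q : SL2R × SL2R} (h : NielsenStep p q) :
    trSL (q.1 * q.2 * q.1⁻¹ * q.2⁻¹) = trSL (p.1 * p.2 * p.1⁻¹ * p.2⁻¹) := by
  cases h with
  | swap a b =>
    rw [trSL_commutator, trSL_commutator, trSL_mul_comm b a]; ring
  | inv a b =>
    simp only [trSL_commutator]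
    rw [trSL_mul_comm, trSL_mul_inv, trSL_inv, trSL_mul_comm b a]; ring
  | mul a b =>
    have h := trSL_mul_inv (b * a) a
    rw [mul_inv_cancel_right, trSL_mul_comm b a] at h
    simp only [trSL_commutator]
    rw [trSL_mul_comm a (b * a), trSL_mul_comm b a, h]; ring

theorem NielsenEquiv.exists_trSL_commutator_eq {U V : SL2R} {q : PSL2R × PSL2R}
    (h : NielsenEquiv (projPSL U, projPSL V) q) :
    ∃ X : SL2R × SL2R, Prod.map projPSL projPSL X = q ∧
      trSL (X.1 * X.2 * X.1⁻¹ * X.2⁻¹) = trSL (U * V * U⁻¹ * V⁻¹) := by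
  induction h with
  | refl => exact ⟨(U, V), rfl, rfl⟩
  | tail _ h ih =>
    obtain ⟨⟨X, Y⟩, rfl, e⟩ := ih
    rw [← e]
    cases h with
    | swap => exact ⟨(Y, X), rfl, (NielsenStep.swap X Y).trSL_commutator_eq⟩
    | inv => exact ⟨(X⁻¹, Y), rfl, (NielsenStep.inv X Y).trSL_commutator_eq⟩
    | mul => exact ⟨(X, Y * X), rfl, (NielsenStep.mul X Y).trSL_commutator_eq⟩

theorem NielsenEquiv.trSL_commutator_eq {U V A B : SL2R}
    (h : NielsenEquiv (projPSL U, projPSL V) (projPSL A, projPSL B)) :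
    trSL (A * B * A⁻¹ * B⁻¹) = trSL (U * V * U⁻¹ * V⁻¹) := by
  obtain ⟨X, hX, e⟩ := h.exists_trSL_commutator_eq
  rw [← e, commutator_eq_of_projPSL_eq (Prod.ext_iff.1 hX).1 (Prod.ext_iff.1 hX).2]

theorem exists_coe_pow_eq (C : SL2R) (n : ℕ) :
    ∃ p q : ℝ, (C ^ n).1 = p • 1 + q • C.1 ∧ p ^ 2 + p * q * trSL C + q ^ 2 = 1 := by
  induction n with
  | zero => exact ⟨1, 0, by simp, by ring⟩
  | succ n ih =>
    obtain ⟨p, q, h, e⟩ := ih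
    refine ⟨-q, p + q * trSL C, ?_, by linear_combination e⟩
    have hC : C.1 * C.1 = trSL C • C.1 - (1 : Matrix (Fin 2) (Fin 2) ℝ) := by
      have hd : C.1 0 0 * C.1 1 1 - C.1 0 1 * C.1 1 0 = 1 := by rw [← det_fin_two]; exact C.2
      rw [trSL]
      ext i j
      fin_cases i <;> fin_cases j <;>
        simp [mul_apply, Fin.sum_univ_two, trace_fin_two, Matrix.sub_apply] <;> linarith
    rw [pow_succ, Matrix.SpecialLinearGroup.coe_mul, h, add_mul, smul_mul_assoc, smul_mul_assoc, hC,
      one_mul, add_smul, mul_smul, smul_sub, neg_smul]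
    abel

/-- The powers of an elliptic element accumulate at the identity. -/
theorem exists_tendsto_pow_of_abs_trSL_lt {C : SL2R} (hC : |trSL C| < 2) :
    ∃ m : ℕ → ℕ, (∀ k, 0 < m k) ∧ Tendsto (fun k => C ^ m k) atTop (𝓝 1) := by
  choose p q h e using exists_coe_pow_eq C
  obtain ⟨hl, hu⟩ := abs_lt.1 hC
  have hR : 0 < 1 - |trSL C| / 2 := by linarith
  set R := (1 - |trSL C| / 2)⁻¹ with hRdef
  have hR1 : 1 ≤ R := by
    rw [hRdef, one_le_inv₀ hR]
    linarith [abs_nonneg (trSL C)]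
  have hb : ∀ n, p n ^ 2 + q n ^ 2 ≤ R := by
    intro n
    rw [hRdef, ← one_div, le_div_iff₀ hR]
    have h1 := neg_abs_le (trSL C)
    have h2 := le_abs_self (trSL C)
    nlinarith [e n, mul_nonneg (sq_nonneg (p n + q n)) (by linarith : 0 ≤ |trSL C| + trSL C),
      mul_nonneg (sq_nonneg (p n - q n)) (by linarith : 0 ≤ |trSL C| - trSL C)]
  have hmem : ∀ n, (p n, q n) ∈ Set.Icc (-R) R ×ˢ Set.Icc (-R) R := by
    intro n
    refine ⟨abs_le.1 (abs_le_of_sq_le_sq ?_ (by linarith)),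
      abs_le.1 (abs_le_of_sq_le_sq ?_ (by linarith))⟩ <;>
    nlinarith [hb n, sq_nonneg (p n), sq_nonneg (q n)]
  obtain ⟨⟨a, b⟩, -, φ, hφ, hlim⟩ := (isCompact_Icc.prod isCompact_Icc).tendsto_subseq hmem
  have hM : Tendsto (fun k => (C ^ φ k).1) atTop (𝓝 (a • 1 + b • C.1)) := by
    simp only [h]
    exact ((hlim.fst_nhds.smul_const _).add (hlim.snd_nhds.smul_const _))
  have hdet : (a • 1 + b • C.1).det = 1 := by
    refine tendsto_nhds_unique ((continuous_id.matrix_det.tendsto _).comp hM) ?_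
    refine tendsto_const_nhds.congr fun k => ?_
    exact (C ^ φ k).2.symm
  obtain ⟨g, hg⟩ : ∃ g : SL2R, Tendsto (fun k => C ^ φ k) atTop (𝓝 g) :=
    ⟨⟨_, hdet⟩, tendsto_subtype_rng.2 hM⟩
  refine ⟨fun k => φ (k + 1) - φ k, fun k => Nat.sub_pos_of_lt (hφ k.lt_succ_self), ?_⟩
  have := hg.inv.mul (hg.comp (tendsto_add_atTop_nat 1))
  rw [inv_mul_cancel] at this
  refine this.congr fun k => ?_
  rw [inv_mul_eq_iff_eq_mul, Function.comp_apply, ← pow_add,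
    Nat.add_sub_cancel' (hφ k.lt_succ_self).le]

theorem IsFreeFuchsianPair.two_le_abs_trSL {a b : PSL2R} (h : IsFreeFuchsianPair a b)
    {w : FreeGroup Bool} (hw : w ≠ 1) {C : SL2R}
    (hC : projPSL C = FreeGroup.lift (fun i : Bool => if i then a else b) w) :
    2 ≤ |trSL C| := by
  obtain ⟨hd, hi⟩ := h
  by_contra! hlt
  obtain ⟨m, hm, hlim⟩ := exists_tendsto_pow_of_abs_trSL_lt hlt
  have hmem : projPSL C ∈ Subgroup.closure {a, b} := by
    rw [← range_lift_eq_closure_pair, hC]; exact ⟨w, rfl⟩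
  set c : Subgroup.closure {a, b} := ⟨projPSL C, hmem⟩ with hc
  have hlim' : Tendsto (fun k => c ^ m k) atTop (𝓝 1) := by
    refine tendsto_subtype_rng.2 ?_
    have := (continuous_projPSL.tendsto 1).comp hlim
    rw [map_one] at this
    refine this.congr fun k => ?_
    simp [hc]
  rw [nhds_discrete, tendsto_pure] at hlim'
  obtain ⟨k, hk⟩ := hlim'.exists
  have h1 : projPSL C ^ m k = 1 := congrArg Subtype.val hk
  rw [hC, ← map_pow] at h1
  have h2 : w ^ m k = 1 := hi (by rw [h1, map_one])
  exact hw ((pow_eq_one_iff_left (hm k).ne').1 h2)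

theorem mul_mul_self_eq_zero {N : Matrix (Fin 2) (Fin 2) ℝ} (hdet : N.det = 0)
    {X : Matrix (Fin 2) (Fin 2) ℝ} (hX : (N * X).trace = 0) : N * X * N = 0 := by
  have key : N * X * N = (N * X).trace • N - N.det • X.adjugate := by
    ext i j
    fin_cases i <;> fin_cases j <;>
      simp [mul_apply, Fin.sum_univ_two, trace_fin_two, Matrix.sub_apply, det_fin_two,
        adjugate_fin_two] <;> ring
  rw [key, hX, hdet, zero_smul, zero_smul, sub_zero]

theorem IsFreeFuchsianPair.trSL_commutator_ne_two {A B : SL2R}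
    (h : IsFreeFuchsianPair (projPSL A) (projPSL B)) : trSL (A * B * A⁻¹ * B⁻¹) ≠ 2 := by
  intro h2
  set C := A * B * A⁻¹ * B⁻¹ with hC
  have hN : (C.1 - 1).det = 0 := by
    have hd : C.1.det = 1 := C.2
    change C.1.trace = 2 at h2
    simp only [det_fin_two, trace_fin_two, Matrix.sub_apply, one_apply] at *
    simp
    linarith
  have h1 : ((C.1 - 1) * B.1).trace = 0 := by
    have e : trSL (C * B) = trSL B := by
      rw [hC, inv_mul_cancel_right, trSL_mul_comm, inv_mul_cancel_left]
    rw [Matrix.sub_mul, trace_sub, Matrix.one_mul, sub_eq_zero]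
    exact e
  have h1' : ((C.1 - 1) * (B⁻¹).1).trace = 0 := by
    have e := trSL_mul_inv C B
    have e' : trSL (C * B) = trSL B := by
      rw [hC, inv_mul_cancel_right, trSL_mul_comm, inv_mul_cancel_left]
    rw [h2, e'] at e
    rw [Matrix.sub_mul, trace_sub, Matrix.one_mul, sub_eq_zero]
    change trSL (C * B⁻¹) = trSL B⁻¹
    rw [e, trSL_inv]; ring
  have e1 := mul_mul_self_eq_zero hN h1
  have e2 := mul_mul_self_eq_zero hN h1'
  have hcomm : C * (B * C * B⁻¹) = B * C * B⁻¹ * C := by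
    apply Subtype.ext
    simp only [Matrix.SpecialLinearGroup.coe_mul]
    obtain ⟨N, hN⟩ : ∃ N, C.1 = 1 + N := ⟨C.1 - 1, by abel⟩
    rw [hN, add_sub_cancel_left] at e1 e2
    rw [hN]
    have hM : B.1 * (1 + N) * (B⁻¹).1 = 1 + B.1 * N * (B⁻¹).1 := by
      rw [Matrix.mul_add, Matrix.mul_one, Matrix.add_mul, coe_mul_coe_inv]
    have l : N * (B.1 * N * (B⁻¹).1) = 0 := by
      rw [← Matrix.mul_assoc, ← Matrix.mul_assoc, e1, Matrix.zero_mul]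
    have r : B.1 * N * (B⁻¹).1 * N = 0 := by
      rw [Matrix.mul_assoc, Matrix.mul_assoc, ← Matrix.mul_assoc N, e2, Matrix.mul_zero]
    rw [hM]
    generalize B.1 * N * (B⁻¹).1 = M at *
    simp only [Matrix.mul_add, Matrix.add_mul, l, r, Matrix.mul_one, Matrix.one_mul]
    abel
  set a : FreeGroup Bool := .of true
  set b : FreeGroup Bool := .of false
  have hw : a * b * a⁻¹ * b⁻¹ * (b * (a * b * a⁻¹ * b⁻¹) * b⁻¹) =
      b * (a * b * a⁻¹ * b⁻¹) * b⁻¹ * (a * b * a⁻¹ * b⁻¹) := by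
    apply h.2
    simpa [a, b, hC] using congrArg projPSL hcomm
  exact absurd hw (by decide)

theorem NielsenEquiv.inv_right {G : Type*} [Group G] (a b : G) : NielsenEquiv (a, b) (a, b⁻¹) :=
  .head (.swap a b) (.head (.inv b a) (.single (.swap b⁻¹ a)))

theorem NielsenEquiv.mul_inv_right {G : Type*} [Group G] (a b : G) :
    NielsenEquiv (a, b) (a * b, b⁻¹) :=
  .head (.swap a b) (.head (.mul b a) (.head (.swap b (a * b)) (NielsenEquiv.inv_right (a * b) b)))

theorem NielsenEquiv.inv_left_mul {G : Type*} [Group G] (a b : G) :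
    NielsenEquiv (a, b) (a⁻¹, a * b) := by
  refine .head (.inv a b) (.trans (NielsenEquiv.inv_right a⁻¹ b) (.head (.mul a⁻¹ b⁻¹) ?_))
  have := NielsenEquiv.inv_right a⁻¹ (b⁻¹ * a⁻¹)
  rwa [_root_.mul_inv_rev, inv_inv, inv_inv] at this

/-- The pair is Nielsen equivalent to a standard pair of generators of a pair of pants. -/
def ReducesToPants (a b : PSL2R) : Prop :=
  ∃ U V : SL2R, 2 ≤ trSL U ∧ trSL U ≤ trSL V ∧ trSL (U * V) ≤ -2 ∧
    NielsenEquiv (projPSL U, projPSL V) (a, b)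

theorem ReducesToPants.of_nielsenEquiv {a b c d : PSL2R} (h : ReducesToPants a b)
    (h' : NielsenEquiv (c, d) (a, b)) : ReducesToPants c d := by
  obtain ⟨U, V, h1, h2, h3, h4⟩ := h
  exact ⟨U, V, h1, h2, h3, .trans h4 h'.symm⟩

theorem reducesToPants_of_trSL_mul_le {X Y : SL2R} (hX : 2 ≤ trSL X) (hY : 2 ≤ trSL Y)
    (hXY : trSL (X * Y) ≤ -2) : ReducesToPants (projPSL X) (projPSL Y) := by
  rcases le_total (trSL X) (trSL Y) with h | h
  · exact ⟨X, Y, hX, h, hXY, .refl⟩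
  · exact ⟨Y, X, hY, h, by rwa [trSL_mul_comm], .single (.swap _ _)⟩

theorem IsFreeFuchsianPair.two_le_abs_trSL_left {X : SL2R} {b : PSL2R}
    (h : IsFreeFuchsianPair (projPSL X) b) : 2 ≤ |trSL X| :=
  h.two_le_abs_trSL (w := .of true) (by decide) (by simp)

theorem IsFreeFuchsianPair.two_le_abs_trSL_right {a : PSL2R} {Y : SL2R}
    (h : IsFreeFuchsianPair a (projPSL Y)) : 2 ≤ |trSL Y| :=
  h.two_le_abs_trSL (w := .of false) (by decide) (by simp)

theorem IsFreeFuchsianPair.two_le_abs_trSL_mul {X Y : SL2R}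
    (h : IsFreeFuchsianPair (projPSL X) (projPSL Y)) : 2 ≤ |trSL (X * Y)| :=
  h.two_le_abs_trSL (w := .of true * .of false) (by decide) (by simp)

theorem IsFreeFuchsianPair.two_le_abs_trSL_commutator {X Y : SL2R}
    (h : IsFreeFuchsianPair (projPSL X) (projPSL Y)) : 2 ≤ |trSL (X * Y * X⁻¹ * Y⁻¹)| :=
  h.two_le_abs_trSL
    (w := .of true * .of false * (.of true)⁻¹ * (.of false)⁻¹) (by decide) (by simp)

/-- The descent estimate for the larger root `z` of the trace equation. -/
theorem le_two_mul_sub_mul {x y z ε : ℝ} (hε : 0 < ε) (hx : 2 ≤ x) (hy : 2 ≤ y) (hxz : x ≤ z)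
    (hyz : y ≤ z) (h : ε ^ 2 = 4 * (x ^ 2 + y ^ 2 + z ^ 2 - x * y * z - 2 - 2)) :
    ε ≤ 2 * z - x * y := by
  wlog hxy : x ≤ y generalizing x y
  · rw [mul_comm x y]
    exact this hy hx hyz hxz (by rw [h]; ring) (le_of_not_ge hxy)
  have h1 : 0 < ε ^ 2 := by positivity
  have h2 : (x - 2) * x ^ 2 ≤ (x - 2) * y ^ 2 := by
    have : 0 ≤ x - 2 := by linarith
    gcongr
  have h3 : 0 ≤ (x - 2) ^ 2 * (x + 1) := by positivity
  have h4 : (z - y) * (x * y - z - y) < 0 := by linear_combination h1 / 4 + h2 + h3 + h / 4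
  have h5 : x * y - z - y < 0 := by
    by_contra! h6
    exact h4.not_ge (mul_nonneg (by linarith) h6)
  have h6 : 2 * 2 ≤ x ^ 2 := by rw [sq]; gcongr
  have h7 : 2 * 2 ≤ y ^ 2 := by rw [sq]; gcongr
  refine abs_le_of_sq_le_sq' ?_ (by linarith) |>.2
  linear_combination h + mul_nonneg (sub_nonneg.2 h6) (sub_nonneg.2 h7)

theorem IsFreeFuchsianPair.reducesToPants_of_le {ε : ℝ} (hε : 0 < ε) (n : ℕ) {X Y : SL2R}
    (h : IsFreeFuchsianPair (projPSL X) (projPSL Y))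
    (hκ : ε ^ 2 = 4 * (trSL (X * Y * X⁻¹ * Y⁻¹) - 2)) (hX : 2 ≤ trSL X) (hY : 2 ≤ trSL Y)
    (hXY : 2 ≤ trSL (X * Y)) (hn : trSL X + trSL Y + trSL (X * Y) ≤ n * ε + 6) :
    ReducesToPants (projPSL X) (projPSL Y) := by
  induction n generalizing X Y with
  | zero =>
    rw [trSL_commutator, show trSL X = 2 by norm_num at hn; linarith,
      show trSL Y = 2 by norm_num at hn; linarith,
      show trSL (X * Y) = 2 by norm_num at hn; linarith] at hκ
    norm_num at hκ
    exact absurd hκ hε.ne'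
  | succ n ih =>
    push_cast at hn
    wlog hmax : trSL X ≤ trSL (X * Y) ∧ trSL Y ≤ trSL (X * Y) generalizing X Y
    · rcases le_total (trSL X) (trSL Y) with hle | hle
      · have e := NielsenEquiv.inv_left_mul (projPSL X) (projPSL Y)
        rw [← map_inv, ← map_mul] at e
        refine ReducesToPants.of_nielsenEquiv (this (h.of_nielsenEquiv e) ?_ ?_ hXY ?_ ?_ ?_) e
        · rw [e.trSL_commutator_eq, hκ]
        · rwa [trSL_inv]
        · rwa [inv_mul_cancel_left]
        · rw [inv_mul_cancel_left, trSL_inv]; linarith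
        · rw [inv_mul_cancel_left, trSL_inv]
          refine ⟨hle, ?_⟩
          by_contra! hlt
          exact hmax ⟨by linarith, hlt.le⟩
      · have e := NielsenEquiv.mul_inv_right (projPSL X) (projPSL Y)
        rw [← map_inv, ← map_mul] at e
        refine ReducesToPants.of_nielsenEquiv (this (h.of_nielsenEquiv e) ?_ hXY ?_ ?_ ?_ ?_) e
        · rw [e.trSL_commutator_eq, hκ]
        · rwa [trSL_inv]
        · rwa [mul_inv_cancel_right]
        · rw [mul_inv_cancel_right, trSL_inv]; linarith
        · rw [mul_inv_cancel_right, trSL_inv]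
          refine ⟨?_, hle⟩
          by_contra! hlt
          exact hmax ⟨hlt.le, by linarith⟩
    have e := NielsenEquiv.inv_right (projPSL X) (projPSL Y)
    rw [← map_inv] at e
    have h' := h.of_nielsenEquiv e
    refine ReducesToPants.of_nielsenEquiv ?_ e
    have hY' : 2 ≤ trSL Y⁻¹ := by rwa [trSL_inv]
    rcases le_abs'.1 h'.two_le_abs_trSL_mul with ht | ht
    · exact reducesToPants_of_trSL_mul_le hX hY' ht
    · refine ih h' (by rw [e.trSL_commutator_eq, hκ]) hX hY' ht ?_
      rw [trSL_commutator] at hκ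
      have := le_two_mul_sub_mul hε hX hY hmax.1 hmax.2 hκ
      rw [trSL_inv, trSL_mul_inv]
      linarith

theorem IsFreeFuchsianPair.reducesToPants {A B : SL2R}
    (h : IsFreeFuchsianPair (projPSL A) (projPSL B)) (hκ : 2 < trSL (A * B * A⁻¹ * B⁻¹)) :
    ReducesToPants (projPSL A) (projPSL B) := by
  wlog hA : 2 ≤ trSL A generalizing A
  · rw [← projPSL_neg A] at h ⊢
    refine this h (by rwa [trSL_commutator_neg_left]) ?_
    rw [projPSL_neg] at h
    rw [trSL_neg]
    linarith [(le_abs'.1 h.two_le_abs_trSL_left).resolve_right hA]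
  wlog hB : 2 ≤ trSL B generalizing B
  · rw [← projPSL_neg B] at h ⊢
    refine this h (by rwa [trSL_commutator_neg_right]) ?_
    rw [projPSL_neg] at h
    rw [trSL_neg]
    linarith [(le_abs'.1 h.two_le_abs_trSL_right).resolve_right hB]
  rcases le_abs'.1 h.two_le_abs_trSL_mul with hAB | hAB
  · exact reducesToPants_of_trSL_mul_le hA hB hAB
  have hε : 0 < √(4 * (trSL (A * B * A⁻¹ * B⁻¹) - 2)) := Real.sqrt_pos.2 (by linarith)
  obtain ⟨n, hn⟩ := exists_nat_gt
    ((trSL A + trSL B + trSL (A * B)) / √(4 * (trSL (A * B * A⁻¹ * B⁻¹) - 2)))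
  rw [div_lt_iff₀ hε] at hn
  exact h.reducesToPants_of_le hε n (Real.sq_sqrt (by linarith)) hA hB hAB (by linarith)

end

/-- (Classification Theorem) For `A, B ∈ SL(2,ℝ)` with images `Ā, B̄ ∈ PSL(2,ℝ)`:
the subgroup `⟨Ā, B̄⟩` of `PSL(2,ℝ)` is a free Fuchsian group of rank 2 freely generated
by `Ā` and `B̄` if and only if either (a) `tr([A,B]) ≤ −2`, or (b) there exist
`U, V ∈ SL(2,ℝ)` with `2 ≤ tr U ≤ tr V` and `tr(UV) ≤ −2` such that `(Ū, V̄)` is Nielsen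
equivalent to `(Ā, B̄)`. Moreover, in case (b) one has `tr([A,B]) ≥ 18`. -/
theorem classification_theorem (A B : SL2R) :
    (IsFreeFuchsianPair (projPSL A) (projPSL B) ↔
      (trSL (A * B * A⁻¹ * B⁻¹) ≤ -2 ∨
        ∃ U V : SL2R, 2 ≤ trSL U ∧ trSL U ≤ trSL V ∧ trSL (U * V) ≤ -2 ∧
          NielsenEquiv (projPSL U, projPSL V) (projPSL A, projPSL B))) ∧
    ((∃ U V : SL2R, 2 ≤ trSL U ∧ trSL U ≤ trSL V ∧ trSL (U * V) ≤ -2 ∧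
          NielsenEquiv (projPSL U, projPSL V) (projPSL A, projPSL B)) →
      18 ≤ trSL (A * B * A⁻¹ * B⁻¹)) := by
  refine ⟨⟨fun h => ?_, ?_⟩, ?_⟩
  · rcases le_abs'.1 h.two_le_abs_trSL_commutator with hκ | hκ
    · exact .inl hκ
    · exact .inr (h.reducesToPants (hκ.lt_of_ne' h.trSL_commutator_ne_two))
  · rintro (h | ⟨U, V, hU, hUV, h, e⟩)
    · exact isFreeFuchsianPair_of_trSL_commutator_le h
    · exact (isFreeFuchsianPair_of_trSL_mul_le hU (hU.trans hUV) h).of_nielsenEquiv e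
  · rintro ⟨U, V, hU, hUV, h, e⟩
    rw [e.trSL_commutator_eq]
    exact eighteen_le_trSL_commutator hU (hU.trans hUV) h
end

section
/- Let A, B ∈ PSL(2,ℝ) generate a subgroup ⟨A,B⟩ that is discrete and freely generated by A and B (a free Fuchsian group of rank 2), and assume tr([A,B]) ≤ −2. Let m, n ≥ 1 be integers and let R, S ∈ PSL(2,ℝ) satisfy Rᵐ = A and Sⁿ = B. Write |tr(A)| = 2·cosh(φ₁) and |tr(B)| = 2·cosh(φ₂) with real numbers φ₁, φ₂ > 0. Then the subgroup ⟨R,S⟩ of PSL(2,ℝ) is discrete and freely generated by R and S if and only if S_m(2·cosh(φ₁/m))² · S_n(2·cosh(φ₂/n))² ≤ 1/2 − (1/4)·tr([A,B]). -/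
/-- Chebyshev S-polynomials for natural indices:
`S 0 = 0`, `S 1 = 1`, `S (n+2) x = x * S (n+1) x - S n x`. -/
noncomputable def chebSNat : ℕ → ℝ → ℝ
  | 0, _ => 0
  | 1, _ => 1
  | n + 2, x => x * chebSNat (n + 1) x - chebSNat n x

/-- Chebyshev S-polynomials for integer indices, with `S m = -S (-m)` for `m < 0`. -/
noncomputable def chebS (m : ℤ) (x : ℝ) : ℝ :=
  if 0 ≤ m then chebSNat m.toNat x else -chebSNat (-m).toNat x

open Matrix Filter Topology

/-! ### Ping-pong on a group -/

/-- The value at the word `L` of the homomorphism from the free group extending `f`, when `L` is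
nonempty and reduced, lies in the ping-pong set of the first letter of `L`. -/
theorem list_prod_mem_of_pingPong {G α : Type*} [Group G] (f : α → G) (U V : α × Bool → Set G)
    (hUV : ∀ l l', l ≠ l' → U l ⊆ V l') (h1 : ∀ l, 1 ∈ V l)
    (hf : ∀ i, ∀ g ∈ V (i, false), f i * g ∈ U (i, true))
    (hf' : ∀ i, ∀ g ∈ V (i, true), (f i)⁻¹ * g ∈ U (i, false))
    (L : List (α × Bool)) (l : α × Bool) (hL : FreeGroup.IsReduced (l :: L)) :
    ((l :: L).map fun x => bif x.2 then f x.1 else (f x.1)⁻¹).prod ∈ U l := by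
  have step : ∀ (l : α × Bool) (g : G), g ∈ V (l.1, !l.2) →
      (bif l.2 then f l.1 else (f l.1)⁻¹) * g ∈ U l := by
    rintro ⟨i, _ | _⟩ g hg
    · exact hf' i g hg
    · exact hf i g hg
  induction L generalizing l with
  | nil => simpa using step l 1 (h1 _)
  | cons l' L ih =>
    rw [List.map_cons, List.prod_cons]
    rw [FreeGroup.IsReduced, List.isChain_cons_cons] at hL
    refine step l _ (hUV l' _ ?_ (ih l' hL.2))
    rintro rfl
    simpa using hL.1

theorem exists_lift_mem_of_pingPong {G α : Type*} [Group G] [DecidableEq α] (f : α → G)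
    (U V : α × Bool → Set G)
    (hUV : ∀ l l', l ≠ l' → U l ⊆ V l') (h1 : ∀ l, 1 ∈ V l)
    (hf : ∀ i, ∀ g ∈ V (i, false), f i * g ∈ U (i, true))
    (hf' : ∀ i, ∀ g ∈ V (i, true), (f i)⁻¹ * g ∈ U (i, false))
    (w : FreeGroup α) (hw : w ≠ 1) : ∃ l, FreeGroup.lift f w ∈ U l := by
  have hred := FreeGroup.isReduced_toWord (x := w)
  rw [← FreeGroup.mk_toWord (x := w), FreeGroup.lift_mk]
  match h : w.toWord with
  | [] => exact absurd (FreeGroup.toWord_eq_nil_iff.1 h) hw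
  | l :: L =>
    rw [h] at hred
    exact ⟨l, list_prod_mem_of_pingPong f U V hUV h1 hf hf' L l hred⟩

/-! ### The area form and the metrics on the plane -/

/-- The area form on the plane. -/
def wedge (x y : Fin 2 → ℝ) : ℝ := x 0 * y 1 - x 1 * y 0

/-- The positive definite form `(x, y) ↦ (p ∧ x) (p ∧ y) + (q ∧ x) (q ∧ y)`. -/
def wedgeForm (p q x y : Fin 2 → ℝ) : ℝ := wedge p x * wedge p y + wedge q x * wedge q y

theorem det_coe_eq (g : SL2R) : g.1 0 0 * g.1 1 1 - g.1 0 1 * g.1 1 0 = 1 := by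
  rw [← det_fin_two, g.2]

theorem wedge_mulVec (g : SL2R) (x y : Fin 2 → ℝ) :
    wedge (g.1 *ᵥ x) (g.1 *ᵥ y) = wedge x y := by
  simp only [wedge, mulVec, dotProduct, Fin.sum_univ_two]
  linear_combination (x 0 * y 1 - x 1 * y 0) * det_coe_eq g

theorem wedgeForm_mulVec (g : SL2R) (p q x y : Fin 2 → ℝ) :
    wedgeForm (g.1 *ᵥ p) (g.1 *ᵥ q) (g.1 *ᵥ x) (g.1 *ᵥ y) = wedgeForm p q x y := by
  simp only [wedgeForm, wedge_mulVec]

theorem wedge_smul_right (r : ℝ) (x y : Fin 2 → ℝ) : wedge x (r • y) = r * wedge x y := by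
  simp [wedge]; ring

theorem wedgeForm_smul_right (r : ℝ) (p q x y : Fin 2 → ℝ) :
    wedgeForm p q x (r • y) = r * wedgeForm p q x y := by
  simp only [wedgeForm, wedge_smul_right]; ring

theorem wedgeForm_comm (p q x y : Fin 2 → ℝ) : wedgeForm p q x y = wedgeForm p q y x := by
  simp only [wedgeForm]; ring

theorem mulVec_ne_zero (g : SL2R) {x : Fin 2 → ℝ} (hx : x ≠ 0) : g.1 *ᵥ x ≠ 0 := by
  intro h
  apply hx
  have := congrArg (fun y => (g⁻¹).1 *ᵥ y) h
  have hg : (g⁻¹).1 * g.1 = 1 := congrArg Subtype.val (inv_mul_cancel g)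
  simpa only [mulVec_mulVec, hg, one_mulVec, mulVec_zero] using this

theorem exists_smul_of_wedge_eq_zero {x y : Fin 2 → ℝ} (hx : x ≠ 0) (h : wedge x y = 0) :
    ∃ r : ℝ, y = r • x := by
  rw [wedge] at h
  by_cases h0 : x 0 = 0
  · have h1 : x 1 ≠ 0 := fun h1 => hx (by ext i; fin_cases i <;> simp [h0, h1])
    refine ⟨y 1 / x 1, ?_⟩
    ext i; fin_cases i
    · simp [h0] at h ⊢; tauto
    · simp [h1]
  · refine ⟨y 0 / x 0, ?_⟩
    ext i; fin_cases i
    · simp [h0]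
    · simp; field_simp; linarith

/-- The linear relation between three vectors of the plane, paired with a fourth one. -/
theorem wedge_mul_wedgeForm (p q x y z u : Fin 2 → ℝ) :
    wedge x z * wedgeForm p q y u =
      wedge y z * wedgeForm p q x u + wedge x y * wedgeForm p q z u := by
  simp only [wedgeForm, wedge]; ring

theorem wedgeForm_cauchy_schwarz (p q x y : Fin 2 → ℝ) :
    wedgeForm p q x x * wedgeForm p q y y - wedgeForm p q x y ^ 2 =
      wedge p q ^ 2 * wedge x y ^ 2 := by
  simp only [wedgeForm, wedge]; ring

theorem wedgeForm_self_pos {p q x : Fin 2 → ℝ} (hpq : wedge p q ≠ 0) (hx : x ≠ 0) :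
    0 < wedgeForm p q x x := by
  refine lt_of_le_of_ne (add_nonneg (mul_self_nonneg _) (mul_self_nonneg _)) fun h => hx ?_
  rw [wedgeForm, eq_comm, mul_self_add_mul_self_eq_zero] at h
  obtain ⟨h1, h2⟩ := h
  simp only [wedge] at *
  have e0 : (p 0 * q 1 - p 1 * q 0) * x 0 = 0 := by linear_combination (-p 0) * h2 + q 0 * h1
  have e1 : (p 0 * q 1 - p 1 * q 0) * x 1 = 0 := by linear_combination (-p 1) * h2 + q 1 * h1
  ext i; fin_cases i
  · simpa [hpq] using e0
  · simpa [hpq] using e1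

/-! ### Ping-pong for a pair with a negative commutator eigenvalue -/

section PingPong

variable {R S : SL2R} {v : Fin 2 → ℝ} {κ : ℝ}

theorem wedge_ne_zero_of_commutator_eigenvector (hv : v ≠ 0) (hκ : κ < 0)
    (h : S.1 *ᵥ (R.1 *ᵥ v) = κ • R.1 *ᵥ (S.1 *ᵥ v)) : wedge v (R.1 *ᵥ v) ≠ 0 := by
  intro h0
  obtain ⟨ρ, hρ⟩ := exists_smul_of_wedge_eq_zero hv h0
  have hρ0 : ρ ≠ 0 := by
    rintro rfl
    exact mulVec_ne_zero R hv (by simpa using hρ)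
  have hu := mulVec_ne_zero S hv
  have hb : wedge (R.1 *ᵥ v) (κ • R.1 *ᵥ (S.1 *ᵥ v)) = κ * wedge v (S.1 *ᵥ v) := by
    rw [wedge_smul_right, wedge_mulVec]
  rw [← h, hρ, mulVec_smul, wedge_smul_right] at hb
  have hb' : (ρ ^ 2 - κ) * wedge v (S.1 *ᵥ v) = 0 := by
    rw [sub_mul, ← hb, wedge, wedge]; simp; ring
  have hb0 : wedge v (S.1 *ᵥ v) = 0 := by
    refine (mul_eq_zero.1 hb').resolve_left ?_
    nlinarith [sq_nonneg ρ]
  obtain ⟨σ, hσ⟩ := exists_smul_of_wedge_eq_zero hv hb0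
  rw [hρ, mulVec_smul, hσ, mulVec_smul, hρ] at h
  have hσ0 : σ ≠ 0 := by
    rintro rfl
    exact hu (by simpa using hσ)
  have h3 : (ρ * σ * (1 - κ)) • v = 0 := by
    rw [smul_smul, smul_smul, smul_smul] at h
    rw [show ρ * σ * (1 - κ) = ρ * σ - κ * σ * ρ by ring, sub_smul, h, sub_self]
  have : ρ * σ * (1 - κ) ≠ 0 := mul_ne_zero (mul_ne_zero hρ0 hσ0) (by linarith)
  exact (smul_ne_zero this hv) h3

/-- The signed functions on `SL(2,ℝ)` cutting out the four half-planes bounded by the sides of the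
ideal quadrilateral with vertices `v`, `R v`, `R S v`, `S v`. Here `true` is the generator `R`, and
`false` is the generator `S`. -/
def sideGap (R S : SL2R) (v : Fin 2 → ℝ) (l : Bool × Bool) (g : SL2R) : ℝ :=
  let F := wedgeForm (g.1 *ᵥ v) (g.1 *ᵥ (R.1 *ᵥ (S.1 *ᵥ v)))
  let c := wedge v (R.1 *ᵥ (S.1 *ᵥ v))
  match l with
  | (true, true) => wedge v (R.1 *ᵥ v) * c * F (R.1 *ᵥ v) (R.1 *ᵥ (S.1 *ᵥ v))
  | (true, false) => -(wedge v (R.1 *ᵥ v) * c * F (S.1 *ᵥ v) v)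
  | (false, true) => wedge v (S.1 *ᵥ v) * c * F (R.1 *ᵥ (S.1 *ᵥ v)) (S.1 *ᵥ v)
  | (false, false) => wedge v (S.1 *ᵥ v) * c * F v (R.1 *ᵥ v)

theorem wedgeForm_mul_coe (h g : SL2R) (p q x y : Fin 2 → ℝ) :
    wedgeForm ((h * g).1 *ᵥ p) ((h * g).1 *ᵥ q) (h.1 *ᵥ x) (h.1 *ᵥ y) =
      wedgeForm (g.1 *ᵥ p) (g.1 *ᵥ q) x y := by
  have (z : Fin 2 → ℝ) : (h * g).1 *ᵥ z = h.1 *ᵥ (g.1 *ᵥ z) := by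
    rw [mulVec_mulVec]; rfl
  rw [this, this, wedgeForm_mulVec]

theorem sideGap_mul_left (g : SL2R) :
    sideGap R S v (true, true) (R * g) = -sideGap R S v (true, false) g := by
  simp only [sideGap, wedgeForm_mul_coe]
  rw [wedgeForm_comm _ _ v]; ring

theorem sideGap_mul_right
    (h : S.1 *ᵥ (R.1 *ᵥ v) = κ • R.1 *ᵥ (S.1 *ᵥ v)) (g : SL2R) :
    κ * sideGap R S v (false, true) (S * g) = sideGap R S v (false, false) g := by
  simp only [sideGap]
  rw [wedgeForm_comm _ _ v, ← wedgeForm_mul_coe S g _ _ (R.1 *ᵥ v) v, h,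
    wedgeForm_comm _ _ (κ • _), wedgeForm_smul_right, wedgeForm_comm _ _ (S.1 *ᵥ v)]
  ring

/-- The values of the side functions in terms of the coefficients of the metric in the basis
`v`, `R S v`. -/
theorem sideGap_eq (h : S.1 *ᵥ (R.1 *ᵥ v) = κ • R.1 *ᵥ (S.1 *ᵥ v)) (g : SL2R)
    {F : (Fin 2 → ℝ) → (Fin 2 → ℝ) → ℝ} {b s : ℝ} {z : Fin 2 → ℝ}
    (hF : F = wedgeForm (g.1 *ᵥ v) (g.1 *ᵥ (R.1 *ᵥ (S.1 *ᵥ v))))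
    (hb : b = wedge v (S.1 *ᵥ v)) (hs : s = wedge (S.1 *ᵥ v) (R.1 *ᵥ (S.1 *ᵥ v)))
    (hz : z = R.1 *ᵥ (S.1 *ᵥ v)) :
    wedge v (R.1 *ᵥ v) = κ * s ∧
    sideGap R S v (true, true) g = κ * (s * b * F v z) + κ ^ 2 * s ^ 2 * F z z ∧
    sideGap R S v (true, false) g = -(κ * (s ^ 2 * F v v + s * b * F v z)) ∧
    sideGap R S v (false, true) g = s * b * F v z + b ^ 2 * F z z ∧
    sideGap R S v (false, false) g = b ^ 2 * F v v + κ * (s * b * F v z) := by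
  have hx1 : wedge (R.1 *ᵥ v) (R.1 *ᵥ (S.1 *ᵥ v)) = b := by rw [hb]; exact wedge_mulVec ..
  have hx2 : wedge v (R.1 *ᵥ v) = κ * s := by
    rw [hs, ← wedge_smul_right, ← h, wedge_mulVec]
  have r1v := wedge_mul_wedgeForm (g.1 *ᵥ v) (g.1 *ᵥ z) v (R.1 *ᵥ v) z v
  have r1z := wedge_mul_wedgeForm (g.1 *ᵥ v) (g.1 *ᵥ z) v (R.1 *ᵥ v) z z
  have r2v := wedge_mul_wedgeForm (g.1 *ᵥ v) (g.1 *ᵥ z) v (S.1 *ᵥ v) z v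
  have r2z := wedge_mul_wedgeForm (g.1 *ᵥ v) (g.1 *ᵥ z) v (S.1 *ᵥ v) z z
  have c1 := wedgeForm_comm (g.1 *ᵥ v) (g.1 *ᵥ z) v z
  have c2 := wedgeForm_comm (g.1 *ᵥ v) (g.1 *ᵥ z) v (R.1 *ᵥ v)
  have c3 := wedgeForm_comm (g.1 *ᵥ v) (g.1 *ᵥ z) z (S.1 *ᵥ v)
  subst hz
  simp only [sideGap]
  rw [hx2, ← hs, ← hb, ← hF, hx1] at *
  refine ⟨rfl, ?_, ?_, ?_, ?_⟩
  · linear_combination κ * s * r1z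
  · linear_combination -κ * s * r2v + κ * s * b * c1
  · rw [c3]; linear_combination b * r2z
  · rw [c2]; linear_combination b * r1v - κ * s * b * c1

theorem quadratic_pos {α β γ x y : ℝ} (hα : 0 < α) (h : 0 < α * γ - β ^ 2) (hy : y ≠ 0) :
    0 < x ^ 2 * α + 2 * (x * y * β) + y ^ 2 * γ := by
  refine pos_of_mul_pos_right (a := α) ?_ hα.le
  have : 0 < (α * γ - β ^ 2) * y ^ 2 := by positivity
  nlinarith [sq_nonneg (α * x + β * y)]

/-- Two different half-planes have disjoint closures. -/
theorem sideGap_pos_of_neg (hv : v ≠ 0) (hκ : κ < 0)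
    (h : S.1 *ᵥ (R.1 *ᵥ v) = κ • R.1 *ᵥ (S.1 *ᵥ v))
    (ha : wedge v (R.1 *ᵥ v) ≠ 0) (hb : wedge v (S.1 *ᵥ v) ≠ 0)
    (hc : wedge v (R.1 *ᵥ (S.1 *ᵥ v)) ≠ 0)
    (g : SL2R) (l l' : Bool × Bool) (hl : l ≠ l') (hlt : sideGap R S v l g < 0) :
    0 < sideGap R S v l' g := by
  have hz : R.1 *ᵥ (S.1 *ᵥ v) ≠ 0 := mulVec_ne_zero R (mulVec_ne_zero S hv)
  have hpq : wedge (g.1 *ᵥ v) (g.1 *ᵥ (R.1 *ᵥ (S.1 *ᵥ v))) ≠ 0 := by rwa [wedge_mulVec]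
  have hα := wedgeForm_self_pos hpq hv
  have hγ := wedgeForm_self_pos hpq hz
  have hCS := wedgeForm_cauchy_schwarz (g.1 *ᵥ v) (g.1 *ᵥ (R.1 *ᵥ (S.1 *ᵥ v))) v
    (R.1 *ᵥ (S.1 *ᵥ v))
  have hCS' : 0 < wedge (g.1 *ᵥ v) (g.1 *ᵥ (R.1 *ᵥ (S.1 *ᵥ v))) ^ 2 *
    wedge v (R.1 *ᵥ (S.1 *ᵥ v)) ^ 2 := by positivity
  rw [← hCS] at hCS'
  obtain ⟨e0, e1, e2, e3, e4⟩ := sideGap_eq h g rfl rfl rfl rfl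
  have hs := right_ne_zero_of_mul (e0 ▸ ha)
  generalize wedgeForm (g.1 *ᵥ v) (g.1 *ᵥ (R.1 *ᵥ (S.1 *ᵥ v))) = F at *
  generalize wedge (S.1 *ᵥ v) (R.1 *ᵥ (S.1 *ᵥ v)) = s at *
  generalize wedge v (S.1 *ᵥ v) = b at *
  generalize R.1 *ᵥ (S.1 *ᵥ v) = z at *
  generalize F v v = α at *
  generalize F z z = γ at *
  generalize F v z = β at *
  obtain ⟨k, hk, rfl⟩ : ∃ k, 0 < k ∧ κ = -k := ⟨-κ, by linarith, by ring⟩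
  have p12 : 0 < sideGap R S v (true, true) g + sideGap R S v (true, false) g := by
    rw [e1, e2]
    have : 0 < k ^ 2 * s ^ 2 * γ + k * s ^ 2 * α := by positivity
    linarith
  have p13 : 0 < sideGap R S v (true, true) g + k * sideGap R S v (false, true) g := by
    rw [e1, e3]
    have : 0 < k ^ 2 * s ^ 2 * γ + k * b ^ 2 * γ := by positivity
    linarith
  have p14 : 0 < sideGap R S v (true, true) g + sideGap R S v (false, false) g := by
    rw [e1, e4]
    have := quadratic_pos (x := b) (y := -(k * s)) hα hCS' (by simp [hk.ne', hs])
    linarith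
  have p23 : 0 < sideGap R S v (true, false) g + k * sideGap R S v (false, true) g := by
    rw [e2, e3]
    have := mul_pos hk (quadratic_pos (x := s) (y := b) hα hCS' hb)
    linarith
  have p24 : 0 < sideGap R S v (true, false) g + sideGap R S v (false, false) g := by
    rw [e2, e4]
    have : 0 < k * s ^ 2 * α + b ^ 2 * α := by positivity
    linarith
  have p34 : 0 < k * sideGap R S v (false, true) g + sideGap R S v (false, false) g := by
    rw [e3, e4]
    have : 0 < k * b ^ 2 * γ + b ^ 2 * α := by positivity
    linarith
  clear e0 e1 e2 e3 e4
  by_contra! hcon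
  have hw (l : Bool × Bool) (hl : sideGap R S v l g ≤ 0) : k * sideGap R S v l g ≤ 0 :=
    mul_nonpos_of_nonneg_of_nonpos hk.le hl
  have hwl := hw l hlt.le
  have hwl' := hw l' hcon
  rcases l with ⟨_ | _, _ | _⟩ <;> rcases l' with ⟨_ | _, _ | _⟩ <;>
    first | exact hl rfl | linarith

theorem wedge_diagonal_ne_zero (hκ : κ < 0)
    (h : S.1 *ᵥ (R.1 *ᵥ v) = κ • R.1 *ᵥ (S.1 *ᵥ v)) (hb : wedge v (S.1 *ᵥ v) ≠ 0) :
    wedge v (R.1 *ᵥ (S.1 *ᵥ v)) ≠ 0 := by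
  have e0 := (sideGap_eq h 1 rfl rfl rfl rfl).1
  have hx1 : wedge (R.1 *ᵥ v) (R.1 *ᵥ (S.1 *ᵥ v)) = wedge v (S.1 *ᵥ v) := wedge_mulVec ..
  have plucker : wedge v (R.1 *ᵥ (S.1 *ᵥ v)) * wedge (R.1 *ᵥ v) (S.1 *ᵥ v) =
      wedge v (S.1 *ᵥ v) * wedge (R.1 *ᵥ v) (R.1 *ᵥ (S.1 *ᵥ v)) -
        wedge v (R.1 *ᵥ v) * wedge (S.1 *ᵥ v) (R.1 *ᵥ (S.1 *ᵥ v)) := by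
    simp only [wedge]; ring
  rw [hx1, e0] at plucker
  intro hc
  rw [hc, zero_mul] at plucker
  have : 0 < wedge v (S.1 *ᵥ v) ^ 2 := by positivity
  nlinarith [sq_nonneg (wedge (S.1 *ᵥ v) (R.1 *ᵥ (S.1 *ᵥ v)))]

theorem sideGap_one_pos (hκ : κ < 0)
    (h : S.1 *ᵥ (R.1 *ᵥ v) = κ • R.1 *ᵥ (S.1 *ᵥ v))
    (ha : wedge v (R.1 *ᵥ v) ≠ 0) (hb : wedge v (S.1 *ᵥ v) ≠ 0)
    (hc : wedge v (R.1 *ᵥ (S.1 *ᵥ v)) ≠ 0) (l : Bool × Bool) : 0 < sideGap R S v l 1 := by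
  obtain ⟨e0, e1, e2, e3, e4⟩ := sideGap_eq h 1 rfl rfl rfl rfl
  have hs := right_ne_zero_of_mul (e0 ▸ ha)
  have hone : (1 : SL2R).1 = 1 := rfl
  simp only [hone, one_mulVec] at e1 e2 e3 e4
  have hF (x y : Fin 2 → ℝ) : wedgeForm x y x x = wedge x y ^ 2 ∧
      wedgeForm x y y y = wedge x y ^ 2 ∧ wedgeForm x y x y = 0 := by
    simp only [wedgeForm, wedge]; refine ⟨?_, ?_, ?_⟩ <;> ring
  rw [(hF _ _).2.2] at e1 e2 e3 e4
  rw [(hF _ _).2.1] at e1 e3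
  rw [(hF _ _).1] at e2 e4
  have hκ' := neg_pos.2 hκ
  have hκ0 := hκ.ne
  rcases l with ⟨_ | _, _ | _⟩
  · rw [e4]; simp only [mul_zero, add_zero]; positivity
  · rw [e3]; simp only [mul_zero, zero_add]; positivity
  · rw [e2, mul_zero, add_zero, ← neg_mul]; exact mul_pos hκ' (by positivity)
  · rw [e1]; simp only [mul_zero, zero_add]; positivity

end PingPong

theorem coe_eq_smul_of_mem_center {Z : SL2R} (h : Z ∈ Subgroup.center SL2R) :
    ∃ r : ℝ, r ^ 2 = 1 ∧ ∀ A : SL2R, (Z * A).1 = r • A.1 := by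
  obtain ⟨r, hr, he⟩ := Matrix.SpecialLinearGroup.mem_center_iff.1 h
  refine ⟨r, by simpa using hr, fun A => ?_⟩
  change Z.1 * A.1 = _
  rw [show Z.1 = scalar (Fin 2) r from he.symm, scalar_apply, ← smul_eq_diagonal_mul]

theorem exists_smul_of_projPSL_eq {A B : SL2R} (h : projPSL A = projPSL B) :
    ∃ r : ℝ, r ^ 2 = 1 ∧ A.1 = r • B.1 := by
  have hmem : B⁻¹ * A ∈ Subgroup.center SL2R := QuotientGroup.eq.1 h.symm
  obtain ⟨r, hr, he⟩ := coe_eq_smul_of_mem_center hmem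
  refine ⟨r, hr, ?_⟩
  rw [← he, ← Subgroup.mem_center_iff.1 hmem B, mul_inv_cancel_left]

theorem det_sub_smul (R S : SL2R) (κ : ℝ) :
    (S.1 * R.1 - κ • (R.1 * S.1)).det = κ ^ 2 - trSL (R * S * R⁻¹ * S⁻¹) * κ + 1 := by
  have hR := det_coe_eq R
  have hS := det_coe_eq S
  have ht : trSL (R * S * R⁻¹ * S⁻¹) = (R.1 * S.1 * R.1.adjugate * S.1.adjugate).trace := rfl
  rw [ht]
  generalize R.1 = r at *
  generalize S.1 = s at *
  simp only [det_fin_two, trace_fin_two, mul_apply, Fin.sum_univ_two, adjugate_fin_two, of_apply,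
    cons_val', cons_val_zero, cons_val_one, Matrix.sub_apply, Matrix.smul_apply, smul_eq_mul]
  linear_combination (κ ^ 2 + 1) * (s 0 0 * s 1 1 - s 0 1 * s 1 0) * hR + (κ ^ 2 + 1) * hS

theorem det_commutator (R S : SL2R) :
    (R.1 * S.1 - S.1 * R.1).det = 2 - trSL (R * S * R⁻¹ * S⁻¹) := by
  have := det_sub_smul R S 1
  rw [one_smul, ← neg_sub, det_neg] at this
  simp only [Fintype.card_fin] at this
  linarith

theorem exists_commutator_eigenvector (R S : SL2R) (h : trSL (R * S * R⁻¹ * S⁻¹) ≤ -2) :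
    ∃ v : Fin 2 → ℝ, ∃ κ : ℝ, v ≠ 0 ∧ κ < 0 ∧
      S.1 *ᵥ (R.1 *ᵥ v) = κ • R.1 *ᵥ (S.1 *ᵥ v) := by
  set t := trSL (R * S * R⁻¹ * S⁻¹) with ht
  have hd : 0 ≤ t ^ 2 - 4 := by nlinarith
  have hroot : ((t - √(t ^ 2 - 4)) / 2) ^ 2 - t * ((t - √(t ^ 2 - 4)) / 2) + 1 = 0 := by
    linear_combination (1 / 4) * Real.sq_sqrt hd
  rw [ht, ← det_sub_smul] at hroot
  obtain ⟨v, hv, he⟩ := exists_mulVec_eq_zero_iff.2 hroot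
  refine ⟨v, (t - √(t ^ 2 - 4)) / 2, hv, ?_, ?_⟩
  · have := Real.sqrt_nonneg (t ^ 2 - 4)
    linarith
  · rw [mulVec_mulVec, mulVec_mulVec, ← sub_eq_zero, ← he, sub_mulVec, smul_mulVec]

theorem projPSL_lift (R S : SL2R) (w : FreeGroup Bool) :
    FreeGroup.lift (fun i : Bool => if i then projPSL R else projPSL S) w =
      projPSL (FreeGroup.lift (fun i : Bool => if i then R else S) w) := by
  rw [← MonoidHom.comp_apply]
  congr 1
  ext i
  cases i <;> simp

theorem continuous_sideGap (R S : SL2R) (v : Fin 2 → ℝ) (l : Bool × Bool) :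
    Continuous (sideGap R S v l) := by
  have h (u : Fin 2 → ℝ) (i : Fin 2) : Continuous fun g : SL2R => (g.1 *ᵥ u) i :=
    (continuous_apply i).comp (continuous_subtype_val.matrix_mulVec continuous_const)
  have hp := h v
  have hq := h (R.1 *ᵥ (S.1 *ᵥ v))
  rcases l with ⟨_ | _, _ | _⟩ <;> unfold sideGap wedgeForm wedge <;> fun_prop

theorem sideGap_eq_of_projPSL_eq (R S : SL2R) (v : Fin 2 → ℝ) (l : Bool × Bool) {g h : SL2R}
    (hgh : projPSL g = projPSL h) : sideGap R S v l g = sideGap R S v l h := by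
  obtain ⟨r, hr, he⟩ := exists_smul_of_projPSL_eq hgh
  have hF (p q x y : Fin 2 → ℝ) : wedgeForm (r • p) (r • q) x y = wedgeForm p q x y := by
    simp only [wedgeForm, wedge, Pi.smul_apply, smul_eq_mul]
    linear_combination ((p 0 * x 1 - p 1 * x 0) * (p 0 * y 1 - p 1 * y 0) +
      (q 0 * x 1 - q 1 * x 0) * (q 0 * y 1 - q 1 * y 0)) * hr
  simp only [sideGap, he, smul_mulVec, hF]

theorem isFreeFuchsianPair_of_trace_commutator_le {R S : SL2R}
    (h : trSL (R * S * R⁻¹ * S⁻¹) ≤ -2) : IsFreeFuchsianPair (projPSL R) (projPSL S) := by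
  obtain ⟨v, κ, hv, hκ, he⟩ := exists_commutator_eigenvector R S h
  have ha := wedge_ne_zero_of_commutator_eigenvector hv hκ he
  have hb : wedge v (S.1 *ᵥ v) ≠ 0 := by
    refine wedge_ne_zero_of_commutator_eigenvector (S := R) (κ := κ⁻¹) hv (inv_lt_zero.2 hκ) ?_
    rw [he, smul_smul, inv_mul_cancel₀ hκ.ne, one_smul]
  have hc := wedge_diagonal_ne_zero hκ he hb
  have hone := sideGap_one_pos hκ he ha hb hc
  set f : Bool → SL2R := fun i => if i then R else S
  have pingPong (w : FreeGroup Bool) (hw : w ≠ 1) :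
      ∃ l, sideGap R S v l (FreeGroup.lift f w) < 0 := by
    refine exists_lift_mem_of_pingPong f (fun l => {g | sideGap R S v l g < 0})
      (fun l => {g | 0 < sideGap R S v l g})
      (fun l l' hl g => sideGap_pos_of_neg hv hκ he ha hb hc g l l' hl) hone ?_ ?_ w hw
    · rintro (_ | _) g hg <;> simp only [Set.mem_ofPred_eq, f] at hg ⊢
      · have := sideGap_mul_right he g
        simp only [Bool.false_eq_true, if_false]
        nlinarith
      · simpa [sideGap_mul_left] using hg
    · rintro (_ | _) g hg <;> simp only [Set.mem_ofPred_eq, f] at hg ⊢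
      · have := sideGap_mul_right he (S⁻¹ * g)
        rw [mul_inv_cancel_left] at this
        simp only [Bool.false_eq_true, if_false]
        nlinarith
      · have := sideGap_mul_left (v := v) (S := S) (R := R) (R⁻¹ * g)
        rw [mul_inv_cancel_left] at this
        simp only [if_true]
        linarith
  have hfree (w : FreeGroup Bool) (g : SL2R) (hg : projPSL g = projPSL (FreeGroup.lift f w))
      (hpos : ∀ l, 0 < sideGap R S v l g) : w = 1 := by
    by_contra hw
    obtain ⟨l, hl⟩ := pingPong w hw
    rw [← sideGap_eq_of_projPSL_eq R S v l hg] at hl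
    exact (hpos l).not_gt hl
  refine ⟨?_, ?_⟩
  · refine discreteTopology_of_isOpen_singleton_one ?_
    set U : Set SL2R := {g | ∀ l, 0 < sideGap R S v l g}
    have hU : IsOpen U := by
      simp only [U, Set.ofPred_forall]
      exact isOpen_iInter_of_finite fun l => isOpen_lt continuous_const (continuous_sideGap R S v l)
    have hU' : IsOpen (projPSL '' U) := QuotientGroup.isOpenMap_coe U hU
    convert hU'.preimage (continuous_subtype_val (p := (· ∈ Subgroup.closure
      ({projPSL R, projPSL S} : Set PSL2R)))) using 1
    ext ⟨x, hx⟩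
    simp only [Set.mem_singleton_iff, Set.mem_preimage, Subgroup.mk_eq_one]
    constructor
    · rintro rfl
      exact ⟨1, hone, map_one _⟩
    · rintro ⟨g, hgU, rfl⟩
      have hrange : Set.range (fun i : Bool => if i then projPSL R else projPSL S) =
          {projPSL R, projPSL S} := by
        ext y; simp [or_comm]
      rw [← hrange, ← FreeGroup.range_lift_eq_closure] at hx
      obtain ⟨w, hw⟩ := hx
      have hw1 := hfree w g (by rw [← hw, projPSL_lift]) hgU
      rw [← hw, hw1, map_one]
  · rw [injective_iff_map_eq_one]
    intro w hw
    rw [projPSL_lift] at hw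
    exact hfree w 1 (by rw [hw, map_one]) hone

/-! ### Powers and Chebyshev polynomials -/

theorem coe_mul_self (K : SL2R) : K.1 * K.1 = trSL K • K.1 - 1 := by
  have hK := det_coe_eq K
  have ht : trSL K = K.1 0 0 + K.1 1 1 := trace_fin_two _
  rw [ht]
  generalize K.1 = k at *
  ext i j
  fin_cases i <;> fin_cases j <;> simp [mul_apply, Fin.sum_univ_two] <;> linarith

theorem coe_pow_succ_eq (K : SL2R) (n : ℕ) :
    (K ^ (n + 1)).1 = chebSNat (n + 1) (trSL K) • K.1 - chebSNat n (trSL K) • 1 := by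
  induction n with
  | zero => simp [chebSNat]
  | succ n ih =>
    have : (K ^ (n + 1 + 1)).1 = (K ^ (n + 1)).1 * K.1 := congrArg Subtype.val (pow_succ K (n + 1))
    rw [this, ih, sub_mul, smul_mul_assoc, coe_mul_self, smul_mul_assoc, one_mul, chebSNat,
      smul_sub, smul_smul, sub_smul, mul_comm (trSL K)]
    abel

theorem chebSNat_sq_sub (n : ℕ) (x : ℝ) :
    chebSNat (n + 1) x ^ 2 - x * chebSNat (n + 1) x * chebSNat n x + chebSNat n x ^ 2 = 1 := by
  induction n with
  | zero => simp [chebSNat]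
  | succ n ih => rw [chebSNat]; linear_combination ih

theorem abs_chebSNat_le {x : ℝ} (h₁ : -2 < x) (h₂ : x < 2) (n : ℕ) :
    |chebSNat n x| ≤ √(4 / (4 - x ^ 2)) := by
  have hx : 0 < 4 - x ^ 2 := by nlinarith
  refine Real.abs_le_sqrt ?_
  rw [le_div_iff₀ hx]
  nlinarith [chebSNat_sq_sub n x, sq_nonneg (2 * chebSNat (n + 1) x - x * chebSNat n x)]

/-- The powers of an elliptic element of `SL(2,ℝ)` have a convergent subsequence. -/
theorem exists_tendsto_pow_of_abs_trace_lt_two {K : SL2R} (h₁ : -2 < trSL K) (h₂ : trSL K < 2) :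
    ∃ L : SL2R, ∃ φ : ℕ → ℕ, StrictMono φ ∧ Tendsto (fun k => K ^ (φ k + 1)) atTop (𝓝 L) := by
  set C := √(4 / (4 - trSL K ^ 2))
  obtain ⟨⟨p, q⟩, -, φ, hφ, hlim⟩ := (isCompact_Icc.prod isCompact_Icc :
    IsCompact (Set.Icc (-C) C ×ˢ Set.Icc (-C) C)).tendsto_subseq
    (x := fun n => (chebSNat (n + 1) (trSL K), chebSNat n (trSL K)))
    (fun n => ⟨abs_le.1 (abs_chebSNat_le h₁ h₂ _), abs_le.1 (abs_chebSNat_le h₁ h₂ _)⟩)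
  have hp : Tendsto (fun k => chebSNat (φ k + 1) (trSL K)) atTop (𝓝 p) :=
    (continuous_fst.tendsto _).comp hlim
  have hq : Tendsto (fun k => chebSNat (φ k) (trSL K)) atTop (𝓝 q) :=
    (continuous_snd.tendsto _).comp hlim
  have hM : Tendsto (fun k => (K ^ (φ k + 1)).1) atTop (𝓝 (p • K.1 - q • 1)) := by
    simp only [coe_pow_succ_eq]
    exact (hp.smul_const _).sub (hq.smul_const _)
  have hdet : (p • K.1 - q • 1).det = 1 := by
    have h := ((continuous_id.matrix_det).tendsto (p • K.1 - q • 1)).comp hM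
    refine tendsto_nhds_unique h (tendsto_const_nhds.congr fun k => ?_)
    exact (K ^ (φ k + 1)).2.symm
  exact ⟨⟨_, hdet⟩, φ, hφ, tendsto_subtype_rng.2 hM⟩

theorem not_isFreeFuchsianPair_of_abs_trace_commutator_lt_two {R S : SL2R}
    (h₁ : -2 < trSL (R * S * R⁻¹ * S⁻¹)) (h₂ : trSL (R * S * R⁻¹ * S⁻¹) < 2) :
    ¬ IsFreeFuchsianPair (projPSL R) (projPSL S) := by
  rintro ⟨hdisc, hinj⟩
  obtain ⟨L, φ, hφ, hlim⟩ := exists_tendsto_pow_of_abs_trace_lt_two h₁ h₂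
  have hstep : Tendsto (fun k => projPSL ((R * S * R⁻¹ * S⁻¹) ^ (φ (k + 1) - φ k))) atTop
      (𝓝 1) := by
    have h := hlim.inv.mul (hlim.comp (tendsto_add_atTop_nat 1))
    rw [inv_mul_cancel] at h
    have hcont : Continuous projPSL := QuotientGroup.continuous_mk
    have h' := (hcont.tendsto 1).comp h
    rw [map_one] at h'
    refine h'.congr fun k => ?_
    have hk : φ (k + 1) + 1 = φ k + 1 + (φ (k + 1) - φ k) := by
      have := hφ k.lt_add_one
      omega
    simp only [Function.comp_apply]
    rw [hk, pow_add _ (φ k + 1), inv_mul_cancel_left]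
  obtain ⟨V, hV, hV1⟩ := discreteTopology_subtype_iff'.1 hdisc 1 (one_mem _)
  have h1V : (1 : PSL2R) ∈ V := (hV1.ge rfl).1
  obtain ⟨k, hk⟩ := (hstep.eventually (hV.mem_nhds h1V)).exists
  have hmem : projPSL ((R * S * R⁻¹ * S⁻¹) ^ (φ (k + 1) - φ k)) ∈
      Subgroup.closure ({projPSL R, projPSL S} : Set PSL2R) := by
    have hRm : projPSL R ∈ Subgroup.closure ({projPSL R, projPSL S} : Set PSL2R) :=
      Subgroup.subset_closure (by simp)
    have hSm : projPSL S ∈ Subgroup.closure ({projPSL R, projPSL S} : Set PSL2R) :=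
      Subgroup.subset_closure (by simp)
    simp only [map_pow, map_mul, map_inv]
    exact pow_mem (mul_mem (mul_mem (mul_mem hRm hSm) (inv_mem hRm)) (inv_mem hSm)) _
  have hone : projPSL ((R * S * R⁻¹ * S⁻¹) ^ (φ (k + 1) - φ k)) = 1 := hV1.le ⟨hk, hmem⟩
  set w : FreeGroup Bool := FreeGroup.of true * FreeGroup.of false * (FreeGroup.of true)⁻¹ *
    (FreeGroup.of false)⁻¹
  have hw : w ≠ 1 := by decide
  have hwk : w ^ (φ (k + 1) - φ k) = 1 := by
    apply hinj
    rw [map_one, ← hone, projPSL_lift]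
    simp [w]
  have hd : φ (k + 1) - φ k ≠ 0 := (Nat.sub_pos_of_lt (hφ k.lt_add_one)).ne'
  exact hw ((pow_eq_one_iff_left hd).1 hwk)

theorem trSL_pow_add_two (R : SL2R) (k : ℕ) :
    trSL (R ^ (k + 2)) = trSL R * trSL (R ^ (k + 1)) - trSL (R ^ k) := by
  have : (R ^ (k + 2)).1 = trSL R • (R ^ (k + 1)).1 - (R ^ k).1 := by
    calc (R ^ (k + 2)).1 = (R ^ k).1 * (R.1 * R.1) := by
          rw [pow_add, pow_two]; rfl
      _ = trSL R • ((R ^ k).1 * R.1) - (R ^ k).1 := by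
          rw [coe_mul_self, mul_sub, mul_smul_comm, mul_one]
      _ = _ := by rw [pow_succ]; rfl
  simp only [trSL]
  rw [this, trace_sub, trace_smul, smul_eq_mul]
  rfl

theorem trSL_one : trSL 1 = 2 := by simp [trSL]

theorem trSL_pow_eq_cosh {R : SL2R} {ψ : ℝ} (h : trSL R = 2 * Real.cosh ψ) (k : ℕ) :
    trSL (R ^ k) = 2 * Real.cosh (k * ψ) := by
  induction k using Nat.twoStepInduction with
  | zero => simp [trSL_one]
  | one => simp [h]
  | more k ih₀ ih₁ =>
    rw [trSL_pow_add_two, ih₀, ih₁, h]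
    have e₂ : ((k + 2 : ℕ) : ℝ) * ψ = (k + 1 : ℕ) * ψ + ψ := by push_cast; ring
    have e₀ : (k : ℝ) * ψ = (k + 1 : ℕ) * ψ - ψ := by push_cast; ring
    rw [e₂, e₀, Real.cosh_add, Real.cosh_sub]
    ring

theorem trSL_pow_eq_cos {R : SL2R} {θ : ℝ} (h : trSL R = 2 * Real.cos θ) (k : ℕ) :
    trSL (R ^ k) = 2 * Real.cos (k * θ) := by
  induction k using Nat.twoStepInduction with
  | zero => simp [trSL_one]
  | one => simp [h]
  | more k ih₀ ih₁ =>
    rw [trSL_pow_add_two, ih₀, ih₁, h]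
    have e₂ : ((k + 2 : ℕ) : ℝ) * θ = (k + 1 : ℕ) * θ + θ := by push_cast; ring
    have e₀ : (k : ℝ) * θ = (k + 1 : ℕ) * θ - θ := by push_cast; ring
    rw [e₂, e₀, Real.cos_add, Real.cos_sub]
    ring

/-- Every root in `PSL(2,ℝ)` of a hyperbolic element lifts to a matrix of trace `2 cosh (φ / m)`. -/
theorem exists_lift_root {R : PSL2R} {A : SL2R} {m : ℕ} {φ : ℝ} (hm : 1 ≤ m) (hφ : 0 < φ)
    (hR : R ^ m = projPSL A) (htr : |trSL A| = 2 * Real.cosh φ) :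
    ∃ R' : SL2R, ∃ r : ℝ, projPSL R' = R ∧ trSL R' = 2 * Real.cosh (φ / m) ∧ r ^ 2 = 1 ∧
      A.1 = r • (R' ^ m).1 := by
  obtain ⟨R', rfl, hnonneg⟩ : ∃ R' : SL2R, projPSL R' = R ∧ 0 ≤ trSL R' := by
    obtain ⟨R₀, rfl⟩ := QuotientGroup.mk'_surjective (Subgroup.center SL2R) R
    rcases le_total 0 (trSL R₀) with h | h
    · exact ⟨R₀, rfl, h⟩
    · refine ⟨-R₀, QuotientGroup.eq.2 ?_, ?_⟩
      · rw [Matrix.SpecialLinearGroup.mem_center_iff]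
        exact ⟨-1, by simp, by rw [map_neg, map_one]; simp⟩
      · simpa [trSL] using h
  rw [← map_pow] at hR
  obtain ⟨r, hr, hA⟩ := exists_smul_of_projPSL_eq hR.symm
  refine ⟨R', r, rfl, ?_, hr, hA⟩
  have hrabs : |r| = 1 := by rwa [← sq_eq_sq₀ (abs_nonneg r) zero_le_one, sq_abs, one_pow]
  have hpow : |trSL (R' ^ m)| = 2 * Real.cosh φ := by
    rw [← htr, trSL, trSL, hA, trace_smul, smul_eq_mul, abs_mul, hrabs, one_mul]
  have hm0 : (0 : ℝ) < m := by exact_mod_cast hm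
  rcases lt_or_ge (trSL R') 2 with hlt | hge
  · exfalso
    have hcos : trSL R' = 2 * Real.cos (Real.arccos (trSL R' / 2)) := by
      rw [Real.cos_arccos (by linarith) (by linarith)]; ring
    rw [trSL_pow_eq_cos hcos, abs_mul, abs_two] at hpow
    have := Real.one_lt_cosh.2 hφ.ne'
    have := Real.abs_cos_le_one (m * Real.arccos (trSL R' / 2))
    linarith
  · obtain ⟨ψ, hψ, hcosh⟩ : ∃ ψ : ℝ, 0 ≤ ψ ∧ Real.cosh ψ = trSL R' / 2 :=
      ⟨Real.arcosh (trSL R' / 2), Real.arcosh_nonneg (by linarith),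
        Real.cosh_arcosh (by linarith)⟩
    have hcosh' : trSL R' = 2 * Real.cosh ψ := by rw [hcosh]; ring
    rw [trSL_pow_eq_cosh hcosh', abs_of_pos (by positivity)] at hpow
    have : (m : ℝ) * ψ = φ :=
      Real.cosh_injOn (Set.mem_Ici.2 (by positivity)) hφ.le (by linarith)
    rw [hcosh', ← this, mul_div_cancel_left₀ _ hm0.ne']

theorem two_sub_trace_commutator_eq {A B R S : SL2R} {m n : ℕ} (hm : 1 ≤ m) (hn : 1 ≤ n) {r s : ℝ}
    (hr : r ^ 2 = 1) (hs : s ^ 2 = 1) (hA : A.1 = r • (R ^ m).1) (hB : B.1 = s • (S ^ n).1) :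
    2 - trSL (A * B * A⁻¹ * B⁻¹) =
      chebSNat m (trSL R) ^ 2 * chebSNat n (trSL S) ^ 2 * (2 - trSL (R * S * R⁻¹ * S⁻¹)) := by
  obtain ⟨m, rfl⟩ := Nat.exists_eq_add_of_le' hm
  obtain ⟨n, rfl⟩ := Nat.exists_eq_add_of_le' hn
  have h : A.1 * B.1 - B.1 * A.1 =
      (r * s * chebSNat (m + 1) (trSL R) * chebSNat (n + 1) (trSL S)) •
        (R.1 * S.1 - S.1 * R.1) := by
    rw [hA, hB, coe_pow_succ_eq, coe_pow_succ_eq]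
    simp only [mul_sub, sub_mul, smul_mul_assoc, mul_smul_comm, smul_sub, smul_smul, one_mul,
      mul_one]
    module
  rw [← det_commutator, ← det_commutator, h, det_smul, Fintype.card_fin]
  linear_combination chebSNat (m + 1) (trSL R) ^ 2 * chebSNat (n + 1) (trSL S) ^ 2 *
    (R.1 * S.1 - S.1 * R.1).det * (s ^ 2 * hr + hs)

/-- Suppose `A, B ∈ PSL(2,ℝ)` form a free Fuchsian pair with commutator trace
`tr([A,B]) ≤ −2` (computed on lifts `A', B' ∈ SL(2,ℝ)`, on which it does not depend),
`Rᵐ = A`, `Sⁿ = B` with `m, n ≥ 1`, and `|tr A| = 2 cosh φ₁`, `|tr B| = 2 cosh φ₂`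
with `φ₁, φ₂ > 0`. Then `⟨R, S⟩` is a free Fuchsian group of rank 2 freely generated
by `R` and `S` if and only if
`S_m(2 cosh(φ₁/m))² · S_n(2 cosh(φ₂/n))² ≤ 1/2 − (1/4)·tr([A,B])`. -/
theorem roots_free_fuchsian_neg_trace
    (A B R S : PSL2R) (A' B' : SL2R)
    (hA' : projPSL A' = A) (hB' : projPSL B' = B)
    (hfree : IsFreeFuchsianPair A B)
    (hτ : trSL (A' * B' * A'⁻¹ * B'⁻¹) ≤ -2)
    (m n : ℕ) (hm : 1 ≤ m) (hn : 1 ≤ n)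
    (hR : R ^ m = A) (hS : S ^ n = B)
    (φ₁ φ₂ : ℝ) (hφ₁ : 0 < φ₁) (hφ₂ : 0 < φ₂)
    (htrA : |trSL A'| = 2 * Real.cosh φ₁) (htrB : |trSL B'| = 2 * Real.cosh φ₂) :
    IsFreeFuchsianPair R S ↔
      chebS m (2 * Real.cosh (φ₁ / m)) ^ 2 * chebS n (2 * Real.cosh (φ₂ / n)) ^ 2 ≤
        1 / 2 - 1 / 4 * trSL (A' * B' * A'⁻¹ * B'⁻¹) := by
  subst hA' hB'
  obtain ⟨R', r, rfl, htR, hr, hA⟩ := exists_lift_root hm hφ₁ hR htrA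
  obtain ⟨S', s, rfl, htS, hs, hB⟩ := exists_lift_root hn hφ₂ hS htrB
  have hkey := two_sub_trace_commutator_eq hm hn hr hs hA hB
  simp only [chebS, Nat.cast_nonneg, if_true, Int.toNat_natCast]
  rw [← htR, ← htS]
  set P := chebSNat m (trSL R') ^ 2 * chebSNat n (trSL S') ^ 2
  have hP : 0 ≤ P := by positivity
  have hlt : trSL (R' * S' * R'⁻¹ * S'⁻¹) < 2 := by
    by_contra! hge
    nlinarith
  have hP0 : P ≠ 0 := by
    intro h0
    rw [h0] at hkey
    linarith
  have hP' : 0 < P := lt_of_le_of_ne hP hP0.symm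
  constructor
  · intro h
    have : trSL (R' * S' * R'⁻¹ * S'⁻¹) ≤ -2 := by
      by_contra! hgt
      exact not_isFreeFuchsianPair_of_abs_trace_commutator_lt_two hgt hlt h
    nlinarith
  · intro h
    apply isFreeFuchsianPair_of_trace_commutator_le
    by_contra! hgt
    nlinarith
end
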